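/- Consider the Gaussian additive model with priors {P_N} satisfying the spread assumption and M_N → ∞. Then {P_N} satisfies the all-or-nothing phenomenon with some critical SNR sequence {λ_N} if and only if D(Q_{2 log M_N, N} ‖ Q_{0,N}) = o(log M_N) as N → ∞. Moreover, when this holds, one may take λ_N = 2 log M_N as the critical SNR. -/

import Mathlib

open MeasureTheory ProbabilityTheory Filter Real
open scoped ENNReal NNReal

noncomputable section

/-- Vectors in `ℝ^N`. -/
abbrev V (N : ℕ) : Type := Fin N → ℝ

/-- Euclidean inner product on `ℝ^N`. -/
def inp {N : ℕ} (x y : V N) : ℝ := ∑ i, x i * y i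

/-- `S` is a subset of the unit sphere of `ℝ^N`. -/
def onSphere {N : ℕ} (S : Finset (V N)) : Prop := ∀ x ∈ S, ∑ i, (x i) ^ 2 = 1

/-- The standard Gaussian measure on `ℝ^N`. -/
def stdGaussian (N : ℕ) : Measure (V N) :=
  Measure.pi fun _ : Fin N => gaussianReal 0 1

/-- The uniform probability measure on a finite set of vectors. -/
def unifOn {N : ℕ} (S : Finset (V N)) : Measure (V N) :=
  (S.card : ℝ≥0∞)⁻¹ • ∑ x ∈ S, Measure.dirac x

/-- The joint law of `(X, Y)` where `X` is uniform on `S`, `Z` is an independent standard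
Gaussian vector, and `Y = √λ • X + Z`. -/
def jointLaw (N : ℕ) (S : Finset (V N)) (lam : ℝ) : Measure (V N × V N) :=
  ((unifOn S).prod (stdGaussian N)).map
    (fun q => (q.1, fun i => Real.sqrt lam * q.1 i + q.2 i))

/-- `Q N S lam` : the law of the observation `Y = √λ • X + Z`. -/
def Q (N : ℕ) (S : Finset (V N)) (lam : ℝ) : Measure (V N) :=
  (jointLaw N S lam).map Prod.snd

/-- Kullback–Leibler divergence `D(μ ‖ ν) = ∫ log (dμ/dν) dμ` (real-valued). -/
def klReal {α : Type*} [MeasurableSpace α] (μ ν : Measure α) : ℝ :=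
  ∫ x, Real.log (μ.rnDeriv ν x).toReal ∂μ

/-- The σ-algebra generated by the observation `Y` (the second coordinate). -/
def sigmaY (N : ℕ) : MeasurableSpace (V N × V N) :=
  MeasurableSpace.comap Prod.snd inferInstance

/-- The minimum mean squared error `E‖X - E[X | Y]‖²` at SNR `lam`. -/
def mmse (N : ℕ) (S : Finset (V N)) (lam : ℝ) : ℝ :=
  ∑ i : Fin N,
    ∫ ω, (ω.1 i - ((jointLaw N S lam)[fun ω' => ω'.1 i | sigmaY N]) ω) ^ 2
      ∂(jointLaw N S lam)

/-- The all-or-nothing phenomenon with critical SNR sequence `lam`. -/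
def allOrNothing (S : ∀ N : ℕ, Finset (V N)) (lam : ℕ → ℝ) : Prop :=
  (∀ β : ℝ, 0 ≤ β → β < 1 →
    Tendsto (fun N => mmse N (S N) (β * lam N)) atTop (nhds 1)) ∧
  (∀ β : ℝ, 1 < β →
    Tendsto (fun N => mmse N (S N) (β * lam N)) atTop (nhds 0))

/-- `limsup_N (1 / log M_N) · log P_N^{⊗2}[⟨X, X'⟩ ≥ t] ≤ c`, where `X, X'` are i.i.d.
draws from the uniform distribution on `S N`: for every `ε > 0`, eventually the probability
that the overlap is at least `t` is at most `M_N ^ (c + ε)`. -/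
def overlapRateLe (S : ∀ N : ℕ, Finset (V N)) (t c : ℝ) : Prop :=
  ∀ ε : ℝ, 0 < ε → ∀ᶠ N in atTop,
    ((unifOn (S N)).prod (unifOn (S N))) {q | t ≤ inp q.1 q.2}
      ≤ ((S N).card : ℝ≥0∞) ^ (c + ε)

/-- The spread assumption: `lim_{t→1⁻} limsup_N (1/log M_N) log P_N^{⊗2}[⟨X,X'⟩ ≥ t] ≤ -1`. -/
def spread (S : ∀ N : ℕ, Finset (V N)) : Prop :=
  ∀ ε : ℝ, 0 < ε → ∃ t₀ : ℝ, t₀ < 1 ∧ ∀ t : ℝ, t₀ < t → t < 1 →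
    overlapRateLe S t (-1 + ε)



instance instProbGamma (N : ℕ) : IsProbabilityMeasure (_root_.stdGaussian N) := by
  unfold _root_.stdGaussian; infer_instance

lemma measurable_inp {N : ℕ} (v : V N) : Measurable (fun y : V N => inp v y) := by
  unfold inp; fun_prop

lemma continuous_inp {N : ℕ} (v : V N) : Continuous (fun y : V N => inp v y) := by
  unfold inp; fun_prop

lemma inp_comm' {N : ℕ} (v w : V N) : inp v w = inp w v := by
  unfold inp; exact Finset.sum_congr rfl fun i _ => mul_comm _ _

lemma inp_add_left {N : ℕ} (u v w : V N) : inp (u + v) w = inp u w + inp v w := by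
  simp [inp, add_mul, Finset.sum_add_distrib]

lemma inp_add_right {N : ℕ} (u v w : V N) : inp w (u + v) = inp w u + inp w v := by
  simp [inp, mul_add, Finset.sum_add_distrib]

lemma inp_smul_left {N : ℕ} (c : ℝ) (v w : V N) : inp (c • v) w = c * inp v w := by
  simp [inp, Finset.mul_sum, mul_assoc]

lemma inp_smul_right {N : ℕ} (c : ℝ) (v w : V N) : inp w (c • v) = c * inp w v := by
  rw [inp_comm', inp_smul_left, inp_comm']

lemma inp_sum_left {N : ℕ} {ι : Type*} (s : Finset ι) (f : ι → V N) (w : V N) :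
    inp (∑ j ∈ s, f j) w = ∑ j ∈ s, inp (f j) w := by
  simp only [inp, Finset.sum_apply, Finset.sum_mul]
  exact Finset.sum_comm

lemma inp_self_nonneg {N : ℕ} (v : V N) : 0 ≤ inp v v :=
  Finset.sum_nonneg fun _ _ => mul_self_nonneg _

lemma inp_cs {N : ℕ} (v w : V N) : (inp v w) ^ 2 ≤ inp v v * inp w w := by
  have := Finset.sum_mul_sq_le_sq_mul_sq Finset.univ v w
  simpa [inp, pow_two] using this

lemma gauss1_density (v y : ℝ) :
    gaussianPDFReal v 1 y = gaussianPDFReal 0 1 y * Real.exp (v * y - v ^ 2 / 2) := by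
  simp only [gaussianPDFReal, NNReal.coe_one]
  rw [mul_assoc _ (Real.exp _) (Real.exp _), ← Real.exp_add]
  congr 2
  ring

lemma gauss1_apply (v : ℝ) (s : Set ℝ) (hs : MeasurableSet s) :
    gaussianReal v 1 s = ENNReal.ofReal (∫ y, s.indicator (fun y => Real.exp (v * y - v ^ 2 / 2)) y
      ∂(gaussianReal 0 1)) := by
  rw [gaussianReal_apply_eq_integral v one_ne_zero s, integral_gaussianReal_eq_integral_smul one_ne_zero,
    ← integral_indicator hs]
  congr 1
  apply integral_congr_ae
  filter_upwards with y
  by_cases hy : y ∈ s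
  · simp [hy, gauss1_density v y]
  · simp [hy]

lemma integrable_exp_lin1 (v c : ℝ) : Integrable (fun y => Real.exp (v * y - c)) (gaussianReal 0 1) := by
  have := (integrable_exp_mul_gaussianReal (μ := 0) (v := 1) v).const_mul (Real.exp (-c))
  refine this.congr ?_
  filter_upwards with y
  rw [← Real.exp_add]; congr 1; ring

lemma exp_inp_eq {N : ℕ} (v y : V N) :
    Real.exp (inp v y - inp v v / 2) = ∏ i, Real.exp (v i * y i - v i ^ 2 / 2) := by
  rw [← Real.exp_sum]
  congr 1
  simp only [inp, Finset.sum_sub_distrib, Finset.sum_div]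
  congr 1
  exact Finset.sum_congr rfl fun i _ => by ring

lemma integrable_exp_inp0 {N : ℕ} (v : V N) :
    Integrable (fun y => Real.exp (inp v y - inp v v / 2)) (_root_.stdGaussian N) := by
  simp_rw [exp_inp_eq]
  exact Integrable.fintype_prod (fun i => integrable_exp_lin1 _ _)

/-- Cameron-Martin. -/
lemma pi_shift {N : ℕ} (v : V N) :
    Measure.pi (fun i => gaussianReal (v i) 1) =
      (_root_.stdGaussian N).withDensity
        (fun y => ENNReal.ofReal (Real.exp (inp v y - inp v v / 2))) := by
  refine Measure.pi_eq fun s hs => ?_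
  have hm : MeasurableSet (Set.pi Set.univ s) := MeasurableSet.univ_pi hs
  rw [withDensity_apply _ hm, ← ofReal_integral_eq_lintegral_ofReal
    (integrable_exp_inp0 v).integrableOn (ae_of_all _ fun _ => (Real.exp_pos _).le)]
  simp_rw [fun i => gauss1_apply (v i) (s i) (hs i)]
  rw [← ENNReal.ofReal_prod_of_nonneg
    (fun i _ => integral_nonneg fun y => Set.indicator_nonneg (fun _ _ => (Real.exp_pos _).le) _)]
  congr 1
  unfold _root_.stdGaussian
  rw [← integral_fintype_prod_eq_prod, ← integral_indicator hm]
  congr 1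
  ext y
  by_cases hy : y ∈ Set.pi Set.univ s
  · rw [Set.indicator_of_mem hy, exp_inp_eq]
    refine Finset.prod_congr rfl fun i _ => ?_
    rw [Set.indicator_of_mem (hy i trivial)]
  · rw [Set.indicator_of_notMem hy]
    simp only [Set.mem_pi, Set.mem_univ, true_implies, not_forall] at hy
    obtain ⟨i, hi⟩ := hy
    exact (Finset.prod_eq_zero (Finset.mem_univ i) (Set.indicator_of_notMem hi _)).symm

lemma map_shift {N : ℕ} (v : V N) :
    (_root_.stdGaussian N).map (fun z => v + z) =
      (_root_.stdGaussian N).withDensity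
        (fun y => ENNReal.ofReal (Real.exp (inp v y - inp v v / 2))) := by
  rw [← pi_shift]
  unfold _root_.stdGaussian
  have := Measure.pi_map_pi (μ := fun _ : Fin N => gaussianReal 0 1)
    (f := fun i y => v i + y) (fun i => by fun_prop)
  simp only [gaussianReal_map_const_add, zero_add] at this
  exact this.symm ▸ rfl

lemma integral_shift {N : ℕ} (v : V N) (φ : V N → ℝ) (hφ : Measurable φ) :
    ∫ y, φ y * Real.exp (inp v y - inp v v / 2) ∂(_root_.stdGaussian N) =
      ∫ z, φ (v + z) ∂(_root_.stdGaussian N) := by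
  have h1 := integral_map (μ := _root_.stdGaussian N) (φ := fun z => v + z) (by fun_prop)
    (f := φ) hφ.aestronglyMeasurable
  rw [← h1, map_shift, integral_withDensity_eq_integral_toReal_smul]
  · refine integral_congr_ae (ae_of_all _ fun y => ?_)
    simp [ENNReal.toReal_ofReal (Real.exp_pos _).le, mul_comm]
  · have := measurable_inp v
    fun_prop
  · simp

lemma integral_exp_inp0 {N : ℕ} (v : V N) :
    ∫ y, Real.exp (inp v y - inp v v / 2) ∂(_root_.stdGaussian N) = 1 := by
  have := integral_shift v (fun _ => 1) measurable_const
  simpa using this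

lemma integrable_exp_inp {N : ℕ} (v : V N) (c : ℝ) :
    Integrable (fun y => Real.exp (inp v y + c)) (_root_.stdGaussian N) := by
  refine ((integrable_exp_inp0 v).const_mul (Real.exp (inp v v / 2 + c))).congr ?_
  filter_upwards with y
  rw [← Real.exp_add]; congr 1; ring

lemma integral_exp_inp {N : ℕ} (v : V N) (c : ℝ) :
    ∫ y, Real.exp (inp v y + c) ∂(_root_.stdGaussian N) = Real.exp (inp v v / 2 + c) := by
  rw [← mul_one (Real.exp (inp v v / 2 + c)), ← integral_exp_inp0 v, ← integral_const_mul]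
  congr 1; ext y
  rw [← Real.exp_add]; congr 1; ring

lemma integrable_inp_exp {N : ℕ} (m v : V N) (c : ℝ) :
    Integrable (fun y => inp m y * Real.exp (inp v y + c)) (_root_.stdGaussian N) := by
  have h1 := integrable_exp_inp (v + m) c
  have h2 := integrable_exp_inp (v - m) c
  refine (h1.add h2).mono' ?_ ?_
  · have := measurable_inp v
    have := measurable_inp m
    fun_prop
  · filter_upwards with y
    have e1 : inp (v + m) y + c = inp m y + (inp v y + c) := by rw [inp_add_left]; ring
    have e2 : inp (v - m) y + c = - inp m y + (inp v y + c) := by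
      rw [sub_eq_add_neg, inp_add_left, ← neg_one_smul ℝ m, inp_smul_left]; ring
    simp only [Pi.add_apply]
    rw [e1, e2, Real.exp_add (inp m y), Real.exp_add (-inp m y), ← add_mul, norm_mul,
      Real.norm_eq_abs, Real.norm_eq_abs, abs_of_pos (Real.exp_pos (inp v y + c))]
    refine mul_le_mul_of_nonneg_right ?_ (Real.exp_pos _).le
    have a1 := Real.add_one_le_exp (inp m y)
    have a2 := Real.add_one_le_exp (-inp m y)
    have a3 := Real.exp_pos (inp m y)
    have a4 := Real.exp_pos (-inp m y)
    rw [abs_le]; constructor <;> linarith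

lemma integrable_inp {N : ℕ} (m : V N) :
    Integrable (fun y => inp m y) (_root_.stdGaussian N) := by
  have := integrable_inp_exp m 0 0
  simpa [inp] using this

lemma integral_inp {N : ℕ} (m : V N) :
    ∫ y, inp m y ∂(_root_.stdGaussian N) = 0 := by
  unfold inp _root_.stdGaussian
  have hi : ∀ i : Fin N, Integrable (fun y : V N => y i)
      (Measure.pi fun _ : Fin N => gaussianReal 0 1) := by
    intro i
    have := integrable_inp (N := N) (Pi.single i 1)
    simpa [inp, Pi.single_apply, _root_.stdGaussian] using this
  rw [integral_finsetSum _ (fun i _ => (hi i).const_mul _)]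
  refine Finset.sum_eq_zero fun i _ => ?_
  rw [integral_const_mul]
  have := integral_comp_eval (μ := fun _ : Fin N => gaussianReal 0 1) (i := i) (f := fun x : ℝ => x)
    (by fun_prop)
  rw [this, integral_id_gaussianReal, mul_zero]

lemma integral_inp_exp0 {N : ℕ} (m v : V N) :
    ∫ y, inp m y * Real.exp (inp v y - inp v v / 2) ∂(_root_.stdGaussian N) = inp m v := by
  rw [integral_shift v _ (measurable_inp m)]
  simp_rw [inp_add_right]
  rw [integral_add (integrable_const _) (integrable_inp m), integral_inp]
  simp

/-- Rotation invariance. -/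
lemma map_rot {N : ℕ} (c d : ℝ) (h : c ^ 2 + d ^ 2 = 1) :
    MeasurePreserving (fun p : V N × V N => c • p.1 + d • p.2)
      ((_root_.stdGaussian N).prod (_root_.stdGaussian N)) (_root_.stdGaussian N) := by
  refine ⟨by fun_prop, ?_⟩
  symm
  have h1 : ((gaussianReal 0 1).prod (gaussianReal 0 1)).map (fun p : ℝ × ℝ => c * p.1 + d * p.2)
      = gaussianReal 0 1 := by
    have hc := gaussianReal_map_const_mul (μ := 0) (v := 1) c
    have hd := gaussianReal_map_const_mul (μ := 0) (v := 1) d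
    have := gaussianReal_conv_gaussianReal (m₁ := c * 0) (m₂ := d * 0)
      (v₁ := NNReal.mk (c ^ 2) (sq_nonneg _) * 1) (v₂ := NNReal.mk (d ^ 2) (sq_nonneg _) * 1)
    rw [← hc, ← hd, Measure.conv, Measure.map_prod_map _ _ (by fun_prop) (by fun_prop),
      Measure.map_map (by fun_prop) (by fun_prop)] at this
    convert this using 2
    · rfl
    · simp
    · apply NNReal.eq; simp [h]
  have h2 := measurePreserving_arrowProdEquivProdArrow ℝ ℝ (Fin N)
    (fun _ => gaussianReal 0 1) (fun _ => gaussianReal 0 1)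
  unfold _root_.stdGaussian
  rw [← h2.map_eq, Measure.map_map (by fun_prop) (MeasurableEquiv.measurable _)]
  have h3 := Measure.pi_map_pi
    (μ := fun _ : Fin N => (gaussianReal 0 1).prod (gaussianReal 0 1))
    (f := fun _ (p : ℝ × ℝ) => c * p.1 + d * p.2) (fun i => by fun_prop)
  simp only [h1] at h3
  rw [← h3]
  rfl


/-- Likelihood ratio. -/
def lik {N : ℕ} (r : ℝ) (x y : V N) : ℝ := Real.exp (r * inp x y - r ^ 2 / 2)

/-- Mixture likelihood ratio. -/
def mix {N : ℕ} (S : Finset (V N)) (w : V N → ℝ) (r : ℝ) (y : V N) : ℝ :=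
  ∑ x ∈ S, w x * lik r x y

/-- Unnormalised posterior mean. -/
def bar {N : ℕ} (S : Finset (V N)) (w : V N → ℝ) (r : ℝ) (y : V N) : V N :=
  ∑ x ∈ S, (w x * lik r x y) • x

/-- Posterior weights. -/
def post {N : ℕ} (S : Finset (V N)) (w : V N → ℝ) (r : ℝ) (y : V N) (x : V N) : ℝ :=
  w x * lik r x y / mix S w r y

/-- Weighted family of unit vectors. -/
structure Good {N : ℕ} (S : Finset (V N)) (w : V N → ℝ) : Prop where
  sph : ∀ x ∈ S, inp x x = 1
  nonneg : ∀ x ∈ S, 0 ≤ w x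
  sum : ∑ x ∈ S, w x = 1

/-- Divergence. -/
def KLf {N : ℕ} (S : Finset (V N)) (w : V N → ℝ) (r : ℝ) : ℝ :=
  ∫ y, mix S w r y * Real.log (mix S w r y) ∂(_root_.stdGaussian N)

/-- Expected squared norm of the posterior mean. -/
def Gf {N : ℕ} (S : Finset (V N)) (w : V N → ℝ) (r : ℝ) : ℝ :=
  ∫ y, inp (bar S w r y) (bar S w r y) / mix S w r y ∂(_root_.stdGaussian N)

lemma lik_pos {N : ℕ} (r : ℝ) (x y : V N) : 0 < lik r x y := Real.exp_pos _

lemma lik_eq {N : ℕ} (r : ℝ) (x y : V N) (hx : inp x x = 1) :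
    lik r x y = Real.exp (inp (r • x) y - inp (r • x) (r • x) / 2) := by
  unfold lik
  rw [inp_smul_left, inp_smul_left, inp_smul_right, hx]
  congr 1; ring

lemma measurable_lik {N : ℕ} (r : ℝ) (x : V N) : Measurable (lik r x) := by
  have := measurable_inp x
  unfold lik; fun_prop

lemma measurable_mix {N : ℕ} (S : Finset (V N)) (w : V N → ℝ) (r : ℝ) :
    Measurable (mix S w r) := by
  unfold mix
  exact Finset.measurable_sum _ fun x _ => (measurable_lik r x).const_mul _

lemma measurable_bar {N : ℕ} (S : Finset (V N)) (w : V N → ℝ) (r : ℝ) :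
    Measurable (bar S w r) := by
  unfold bar
  exact Finset.measurable_sum _ fun x _ => ((measurable_lik r x).const_mul _).smul_const _

lemma measurable_inp2 {N : ℕ} {α : Type*} [MeasurableSpace α] {f g : α → V N}
    (hf : Measurable f) (hg : Measurable g) : Measurable (fun a => inp (f a) (g a)) := by
  unfold inp; fun_prop

lemma integrable_lik {N : ℕ} (r : ℝ) (x : V N) :
    Integrable (lik r x) (_root_.stdGaussian N) := by
  refine (integrable_exp_inp (r • x) (- (r ^ 2 / 2))).congr (ae_of_all _ fun y => ?_)
  simp only [lik, inp_smul_left, sub_eq_add_neg]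

lemma integral_lik {N : ℕ} (r : ℝ) (x : V N) (hx : inp x x = 1) :
    ∫ y, lik r x y ∂(_root_.stdGaussian N) = 1 := by
  simp_rw [lik_eq r x _ hx]
  exact integral_exp_inp0 _

lemma integrable_inp_lik {N : ℕ} (r : ℝ) (m x : V N) :
    Integrable (fun y => inp m y * lik r x y) (_root_.stdGaussian N) := by
  refine (integrable_inp_exp m (r • x) (- (r ^ 2 / 2))).congr (ae_of_all _ fun y => ?_)
  simp only [lik, inp_smul_left, sub_eq_add_neg]

lemma integral_inp_lik {N : ℕ} (r : ℝ) (m x : V N) (hx : inp x x = 1) :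
    ∫ y, inp m y * lik r x y ∂(_root_.stdGaussian N) = r * inp m x := by
  simp_rw [lik_eq r x _ hx]
  rw [integral_inp_exp0, inp_smul_right]

lemma lik_mul_lik {N : ℕ} (r : ℝ) (x x' y : V N) :
    lik r x y * lik r x' y = Real.exp (inp (r • (x + x')) y + (- r ^ 2)) := by
  unfold lik
  rw [← Real.exp_add, inp_smul_left, inp_add_left]; congr 1; ring

lemma integrable_lik_mul {N : ℕ} (r : ℝ) (x x' : V N) :
    Integrable (fun y => lik r x y * lik r x' y) (_root_.stdGaussian N) := by
  simp_rw [lik_mul_lik]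
  exact integrable_exp_inp _ _

section
variable {N : ℕ} {S : Finset (V N)} {w : V N → ℝ}

lemma abs_inp_le_one (h : Good S w) {x x' : V N} (hx : x ∈ S) (hx' : x' ∈ S) :
    |inp x x'| ≤ 1 := by
  have := inp_cs x x'
  rw [h.sph x hx, h.sph x' hx'] at this
  rw [← sq_le_one_iff_abs_le_one]; linarith

lemma mix_pos (h : Good S w) (r : ℝ) (y : V N) : 0 < mix S w r y := by
  have h0 : 0 ≤ mix S w r y :=
    Finset.sum_nonneg fun x hx => mul_nonneg (h.nonneg x hx) (lik_pos _ _ _).le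
  rcases h0.lt_or_eq with h1 | h1
  · exact h1
  · exfalso
    have h2 := (Finset.sum_eq_zero_iff_of_nonneg
      (fun x hx => mul_nonneg (h.nonneg x hx) (lik_pos r x y).le)).1 h1.symm
    have h3 : ∑ x ∈ S, w x = 0 := Finset.sum_eq_zero fun x hx =>
      (mul_eq_zero.1 (h2 x hx)).resolve_right (lik_pos r x y).ne'
    rw [h.sum] at h3
    exact one_ne_zero h3

lemma integrable_mix (S : Finset (V N)) (w : V N → ℝ) (r : ℝ) :
    Integrable (mix S w r) (_root_.stdGaussian N) := by
  unfold mix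
  exact integrable_finsetSum _ fun x _ => (integrable_lik r x).const_mul _

lemma integral_mix (h : Good S w) (r : ℝ) :
    ∫ y, mix S w r y ∂(_root_.stdGaussian N) = 1 := by
  unfold mix
  rw [integral_finsetSum _ fun x _ => (integrable_lik r x).const_mul _, ← h.sum]
  refine Finset.sum_congr rfl fun x hx => ?_
  rw [integral_const_mul, integral_lik r x (h.sph x hx), mul_one]

lemma integrable_mix_sq (S : Finset (V N)) (w : V N → ℝ) (r : ℝ) :
    Integrable (fun y => mix S w r y * mix S w r y) (_root_.stdGaussian N) := by
  unfold mix
  simp_rw [Finset.sum_mul_sum]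
  refine integrable_finsetSum _ fun x _ => integrable_finsetSum _ fun x' _ => ?_
  refine ((integrable_lik_mul r x x').const_mul (w x * w x')).congr (ae_of_all _ fun y => ?_)
  ring

lemma mul_log_lower {t : ℝ} (ht : 0 < t) : t - 1 ≤ t * Real.log t := by
  have := Real.one_sub_inv_le_log_of_pos ht
  have := mul_le_mul_of_nonneg_left this ht.le
  rwa [mul_sub, mul_one, mul_inv_cancel₀ ht.ne'] at this

lemma mul_log_upper {t : ℝ} (ht : 0 < t) : t * Real.log t ≤ t * t - t := by
  have := Real.log_le_sub_one_of_pos ht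
  nlinarith

lemma integrable_mix_log (h : Good S w) (r : ℝ) :
    Integrable (fun y => mix S w r y * Real.log (mix S w r y)) (_root_.stdGaussian N) := by
  refine ((integrable_mix_sq S w r).add (integrable_const 1)).mono' ?_ (ae_of_all _ fun y => ?_)
  · have := measurable_mix S w r
    fun_prop
  · have hp := mix_pos h r y
    have h1 := mul_log_lower hp
    have h2 := mul_log_upper hp
    have h3 := mul_self_nonneg (mix S w r y)
    simp only [Pi.add_apply, Real.norm_eq_abs]
    rw [abs_le]; constructor <;> linarith

lemma KLf_nonneg (h : Good S w) (r : ℝ) : 0 ≤ KLf S w r := by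
  have : ∫ y, (mix S w r y - 1) ∂(_root_.stdGaussian N) ≤ KLf S w r :=
    integral_mono ((integrable_mix S w r).sub (integrable_const 1)) (integrable_mix_log h r)
      fun y => mul_log_lower (mix_pos h r y)
  rw [integral_sub (integrable_mix S w r) (integrable_const 1), integral_mix h] at this
  simpa using this

/-- mean -/
def mean (S : Finset (V N)) (w : V N → ℝ) : V N := ∑ x ∈ S, w x • x

lemma inp_mean_left (y : V N) : inp (mean S w) y = ∑ x ∈ S, w x * inp x y := by
  unfold mean
  rw [inp_sum_left]
  simp_rw [inp_smul_left]

lemma inp_mean_right (y : V N) : inp y (mean S w) = ∑ x ∈ S, w x * inp y x := by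
  rw [inp_comm', inp_mean_left]
  simp_rw [inp_comm' y]

lemma integrable_inp_mix (S : Finset (V N)) (w : V N → ℝ) (r : ℝ) (m : V N) :
    Integrable (fun y => inp m y * mix S w r y) (_root_.stdGaussian N) := by
  unfold mix
  simp_rw [Finset.mul_sum]
  refine integrable_finsetSum _ fun x _ => ?_
  refine ((integrable_inp_lik r m x).const_mul (w x)).congr (ae_of_all _ fun y => ?_)
  ring

lemma integral_inp_mix (h : Good S w) (r : ℝ) (m : V N) :
    ∫ y, inp m y * mix S w r y ∂(_root_.stdGaussian N) = r * inp m (mean S w) := by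
  unfold mix
  simp_rw [Finset.mul_sum]
  have e : ∀ x y, inp m y * (w x * lik r x y) = w x * (inp m y * lik r x y) := by
    intros; ring
  simp_rw [e]
  rw [integral_finsetSum _ fun x _ => (integrable_inp_lik r m x).const_mul (w x),
    inp_mean_right, Finset.mul_sum]
  refine Finset.sum_congr rfl fun x hx => ?_
  rw [integral_const_mul, integral_inp_lik r m x (h.sph x hx)]; ring

/-- log of the Gaussian tilt by the mean -/
def lg (S : Finset (V N)) (w : V N → ℝ) (r : ℝ) (z : V N) : ℝ :=
  r * inp (mean S w) z - r ^ 2 * inp (mean S w) (mean S w) / 2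

lemma integrable_mix_lg (S : Finset (V N)) (w : V N → ℝ) (r : ℝ) :
    Integrable (fun y => mix S w r y * lg S w r y) (_root_.stdGaussian N) := by
  refine (((integrable_inp_mix S w r (mean S w)).const_mul r).sub
    ((integrable_mix S w r).const_mul (r ^ 2 * inp (mean S w) (mean S w) / 2))).congr
    (ae_of_all _ fun y => ?_)
  simp only [lg, Pi.sub_apply]; ring

lemma integral_mix_lg (h : Good S w) (r : ℝ) :
    ∫ y, mix S w r y * lg S w r y ∂(_root_.stdGaussian N) =
      r ^ 2 / 2 * inp (mean S w) (mean S w) := by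
  have e : ∀ y, mix S w r y * lg S w r y = r * (inp (mean S w) y * mix S w r y) -
      (r ^ 2 * inp (mean S w) (mean S w) / 2) * mix S w r y := by
    intro y; simp only [lg]; ring
  simp_rw [e]
  rw [integral_sub ((integrable_inp_mix S w r (mean S w)).const_mul r)
    ((integrable_mix S w r).const_mul _), integral_const_mul, integral_const_mul,
    integral_inp_mix h, integral_mix h]
  ring

lemma exp_lg_eq (S : Finset (V N)) (w : V N → ℝ) (r : ℝ) (z : V N) :
    Real.exp (lg S w r z) = Real.exp (inp (r • mean S w) z
      - inp (r • mean S w) (r • mean S w) / 2) := by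
  unfold lg
  rw [inp_smul_left, inp_smul_left, inp_smul_right]
  congr 1; ring

lemma KLf_lower (h : Good S w) (r : ℝ) :
    r ^ 2 / 2 * inp (mean S w) (mean S w) ≤ KLf S w r := by
  have i1 : Integrable (fun z => Real.exp (lg S w r z)) (_root_.stdGaussian N) := by
    simp_rw [exp_lg_eq]; exact integrable_exp_inp0 _
  have i2 : ∫ z, Real.exp (lg S w r z) ∂(_root_.stdGaussian N) = 1 := by
    simp_rw [exp_lg_eq]; exact integral_exp_inp0 _
  have : ∫ y, (mix S w r y * lg S w r y + (mix S w r y - Real.exp (lg S w r y)))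
      ∂(_root_.stdGaussian N) ≤ KLf S w r := by
    refine integral_mono ((integrable_mix_lg S w r).add ((integrable_mix S w r).sub i1))
      (integrable_mix_log h r) fun y => ?_
    have hp := mix_pos h r y
    have he := Real.exp_pos (lg S w r y)
    have := mul_log_lower (div_pos hp he)
    rw [Real.log_div hp.ne' he.ne', Real.log_exp] at this
    have h2 := mul_le_mul_of_nonneg_left this he.le
    have e1 : Real.exp (lg S w r y) * (mix S w r y / Real.exp (lg S w r y) - 1)
      = mix S w r y - Real.exp (lg S w r y) := by field_simp
    have e2 : Real.exp (lg S w r y) * (mix S w r y / Real.exp (lg S w r y) *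
      (Real.log (mix S w r y) - lg S w r y)) =
      mix S w r y * (Real.log (mix S w r y) - lg S w r y) := by field_simp
    rw [e1, e2] at h2
    simp only
    linarith
  have j : Integrable (fun y => mix S w r y - Real.exp (lg S w r y)) (_root_.stdGaussian N) :=
    (integrable_mix S w r).sub i1
  rw [integral_add (integrable_mix_lg S w r) j,
    integral_sub (integrable_mix S w r) i1, integral_mix h, i2, integral_mix_lg h] at this
  linarith

lemma mean_sq_le (h : Good S w) : inp (mean S w) (mean S w) ≤ 1 := by
  rw [inp_mean_left, ← h.sum]
  refine Finset.sum_le_sum fun x hx => ?_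
  refine mul_le_of_le_one_right (h.nonneg x hx) ?_
  rw [inp_mean_right, ← h.sum]
  refine Finset.sum_le_sum fun x' hx' => ?_
  exact mul_le_of_le_one_right (h.nonneg x' hx') (abs_le.1 (abs_inp_le_one h hx hx')).2

lemma abs_inp_mean_le (h : Good S w) {x : V N} (hx : x ∈ S) : |inp x (mean S w)| ≤ 1 := by
  have := inp_cs x (mean S w)
  rw [h.sph x hx] at this
  have := mean_sq_le h
  rw [← sq_le_one_iff_abs_le_one]; linarith

/-- centred overlap -/
def cov (S : Finset (V N)) (w : V N → ℝ) (x x' : V N) : ℝ :=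
  inp x x' - inp x (mean S w) - inp x' (mean S w) + inp (mean S w) (mean S w)

lemma sum_cov (h : Good S w) : ∑ x ∈ S, ∑ x' ∈ S, w x * w x' * cov S w x x' = 0 := by
  have e : ∀ x ∈ S, ∑ x' ∈ S, w x * w x' * cov S w x x' = 0 := by
    intro x _
    have : ∀ x', w x * w x' * cov S w x x' = w x * (w x' * inp x x') - w x * inp x (mean S w) * w x'
      - w x * (w x' * inp x' (mean S w)) + w x * inp (mean S w) (mean S w) * w x' := by
      intro x'; unfold cov; ring
    simp_rw [this, Finset.sum_add_distrib, Finset.sum_sub_distrib, ← Finset.mul_sum,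
      ← inp_mean_right, ← inp_mean_left, h.sum]
    ring
  exact Finset.sum_eq_zero e

lemma KLf_upper (h : Good S w) (r : ℝ) (hr : r ^ 2 ≤ 1 / 4) :
    KLf S w r ≤ r ^ 2 / 2 * inp (mean S w) (mean S w) + 16 * r ^ 4 := by
  have e : ∀ x ∈ S, ∀ x' ∈ S, ∀ y, lik r x y * lik r x' y * Real.exp (- lg S w r y) =
      Real.exp (inp (r • (x + x' - mean S w)) y +
        (- r ^ 2 + r ^ 2 * inp (mean S w) (mean S w) / 2)) := by
    intro x _ x' _ y
    rw [lik_mul_lik, ← Real.exp_add]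
    congr 1
    unfold lg
    rw [inp_smul_left, inp_smul_left, sub_eq_add_neg (x + x'), ← neg_one_smul ℝ (mean S w),
      inp_add_left (x + x'), inp_smul_left]
    ring
  have i0 : ∀ x ∈ S, ∀ x' ∈ S, Integrable (fun y => lik r x y * lik r x' y *
      Real.exp (- lg S w r y)) (_root_.stdGaussian N) := by
    intro x hx x' hx'
    simp_rw [e x hx x' hx']
    exact integrable_exp_inp _ _
  have i1 : ∀ x ∈ S, ∀ x' ∈ S, ∫ y, lik r x y * lik r x' y *
      Real.exp (- lg S w r y) ∂(_root_.stdGaussian N) = Real.exp (r ^ 2 * cov S w x x') := by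
    intro x hx x' hx'
    simp_rw [e x hx x' hx']
    rw [integral_exp_inp]
    congr 1
    have : inp (x + x' - mean S w) (x + x' - mean S w) =
        inp x x + inp x' x' + inp (mean S w) (mean S w) + 2 * inp x x' - 2 * inp x (mean S w)
        - 2 * inp x' (mean S w) := by
      rw [sub_eq_add_neg, ← neg_one_smul ℝ (mean S w)]
      simp only [inp_add_left, inp_add_right, inp_smul_left, inp_smul_right]
      rw [inp_comm' x' x, inp_comm' (mean S w) x, inp_comm' (mean S w) x']
      ring
    rw [inp_smul_left, inp_smul_right, this, h.sph x hx, h.sph x' hx']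
    unfold cov
    ring
  have e2 : ∀ y, mix S w r y * mix S w r y * Real.exp (- lg S w r y) =
      ∑ x ∈ S, ∑ x' ∈ S, w x * w x' * (lik r x y * lik r x' y * Real.exp (- lg S w r y)) := by
    intro y
    unfold mix
    rw [Finset.sum_mul_sum, Finset.sum_mul]
    refine Finset.sum_congr rfl fun x _ => ?_
    rw [Finset.sum_mul]
    exact Finset.sum_congr rfl fun x' _ => by ring
  have i2 : Integrable (fun y => mix S w r y * mix S w r y * Real.exp (- lg S w r y))
      (_root_.stdGaussian N) := by
    simp_rw [e2]
    exact integrable_finsetSum _ fun x hx => integrable_finsetSum _ fun x' hx' =>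
      (i0 x hx x' hx').const_mul _
  have i3 : ∫ y, mix S w r y * mix S w r y * Real.exp (- lg S w r y) ∂(_root_.stdGaussian N)
      = ∑ x ∈ S, ∑ x' ∈ S, w x * w x' * Real.exp (r ^ 2 * cov S w x x') := by
    simp_rw [e2]
    rw [integral_finsetSum _ fun x hx => integrable_finsetSum _ fun x' hx' =>
      (i0 x hx x' hx').const_mul _]
    refine Finset.sum_congr rfl fun x hx => ?_
    rw [integral_finsetSum _ fun x' hx' => (i0 x hx x' hx').const_mul _]
    refine Finset.sum_congr rfl fun x' hx' => ?_
    rw [integral_const_mul, i1 x hx x' hx']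
  have b3 : ∑ x ∈ S, ∑ x' ∈ S, w x * w x' * Real.exp (r ^ 2 * cov S w x x') ≤ 1 + 16 * r ^ 4 := by
    have : ∑ x ∈ S, ∑ x' ∈ S, w x * w x' * Real.exp (r ^ 2 * cov S w x x') ≤
        ∑ x ∈ S, ∑ x' ∈ S, ((1 + 16 * r ^ 4) * (w x * w x') + r ^ 2 *
          (w x * w x' * cov S w x x')) := by
      refine Finset.sum_le_sum fun x hx => Finset.sum_le_sum fun x' hx' => ?_
      have hc : |cov S w x x'| ≤ 4 := by
        have a1 := abs_le.1 (abs_inp_le_one h hx hx')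
        have a2 := abs_le.1 (abs_inp_mean_le h hx)
        have a3 := abs_le.1 (abs_inp_mean_le h hx')
        have a4 := mean_sq_le h
        have a5 := inp_self_nonneg (mean S w)
        unfold cov
        rw [abs_le]; constructor <;> linarith
      have hc1 : |r ^ 2 * cov S w x x'| ≤ 1 := by
        rw [abs_mul, abs_of_nonneg (sq_nonneg r)]
        nlinarith [abs_nonneg (cov S w x x'), sq_nonneg r]
      have h5 := abs_le.1 (Real.abs_exp_sub_one_sub_id_le hc1)
      have h6 : (r ^ 2 * cov S w x x') ^ 2 ≤ 16 * r ^ 4 := by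
        have : cov S w x x' ^ 2 ≤ 16 := by
          rw [← sq_abs]; nlinarith [abs_nonneg (cov S w x x')]
        nlinarith [sq_nonneg (r ^ 2)]
      have h7 : Real.exp (r ^ 2 * cov S w x x') ≤ 1 + 16 * r ^ 4 + r ^ 2 * cov S w x x' := by
        linarith [h5.2]
      have := mul_le_mul_of_nonneg_left h7 (mul_nonneg (h.nonneg x hx) (h.nonneg x' hx'))
      linarith
    refine this.trans ?_
    simp_rw [Finset.sum_add_distrib, ← Finset.mul_sum]
    simp_rw [sum_cov h, h.sum]
    simp [h.sum]
  have : KLf S w r ≤ ∫ y, (mix S w r y * lg S w r y + (mix S w r y * mix S w r y *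
      Real.exp (- lg S w r y) - mix S w r y)) ∂(_root_.stdGaussian N) := by
    refine integral_mono (integrable_mix_log h r)
      ((integrable_mix_lg S w r).add (i2.sub (integrable_mix S w r))) fun y => ?_
    have hp := mix_pos h r y
    have he := Real.exp_pos (- lg S w r y)
    have := Real.log_le_sub_one_of_pos (mul_pos hp he)
    rw [Real.log_mul hp.ne' he.ne', Real.log_exp] at this
    have h2 := mul_le_mul_of_nonneg_left this hp.le
    simp only
    linarith
  have j : Integrable (fun y => mix S w r y * mix S w r y * Real.exp (- lg S w r y)
      - mix S w r y) (_root_.stdGaussian N) := i2.sub (integrable_mix S w r)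
  rw [integral_add (integrable_mix_lg S w r) j,
    integral_sub i2 (integrable_mix S w r), integral_mix h, i3, integral_mix_lg h] at this
  linarith

end


section
variable {N : ℕ} {S : Finset (V N)} {w : V N → ℝ}

lemma inp_bar_left (r : ℝ) (y m : V N) :
    inp (bar S w r y) m = ∑ x ∈ S, w x * inp x m * lik r x y := by
  unfold bar
  rw [inp_sum_left]
  refine Finset.sum_congr rfl fun x _ => ?_
  rw [inp_smul_left]; ring

lemma inp_bar_bar (r : ℝ) (y : V N) :
    inp (bar S w r y) (bar S w r y) =
      ∑ x ∈ S, ∑ x' ∈ S, (w x * lik r x y) * (w x' * lik r x' y) * inp x x' := by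
  rw [inp_bar_left]
  refine Finset.sum_congr rfl fun x _ => ?_
  rw [inp_comm' x, inp_bar_left, Finset.mul_sum, Finset.sum_mul]
  refine Finset.sum_congr rfl fun x' _ => ?_
  rw [inp_comm' x' x]; ring

lemma bar_sq_le (h : Good S w) (r : ℝ) (y : V N) :
    inp (bar S w r y) (bar S w r y) ≤ mix S w r y * mix S w r y := by
  rw [inp_bar_bar]
  unfold mix
  rw [Finset.sum_mul_sum]
  refine Finset.sum_le_sum fun x hx => Finset.sum_le_sum fun x' hx' => ?_
  refine mul_le_of_le_one_right (mul_nonneg (mul_nonneg (h.nonneg x hx) (lik_pos _ _ _).le)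
    (mul_nonneg (h.nonneg x' hx') (lik_pos _ _ _).le)) ?_
  exact (abs_le.1 (abs_inp_le_one h hx hx')).2

lemma Gint_nonneg (h : Good S w) (r : ℝ) (y : V N) :
    0 ≤ inp (bar S w r y) (bar S w r y) / mix S w r y :=
  div_nonneg (inp_self_nonneg _) (mix_pos h r y).le

lemma Gint_le (h : Good S w) (r : ℝ) (y : V N) :
    inp (bar S w r y) (bar S w r y) / mix S w r y ≤ mix S w r y := by
  rw [div_le_iff₀ (mix_pos h r y)]; exact bar_sq_le h r y

lemma integrable_Gint (h : Good S w) (r : ℝ) :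
    Integrable (fun y => inp (bar S w r y) (bar S w r y) / mix S w r y)
      (_root_.stdGaussian N) := by
  refine (integrable_mix S w r).mono' ?_ (ae_of_all _ fun y => ?_)
  · exact ((measurable_inp2 (measurable_bar S w r) (measurable_bar S w r)).div
      (measurable_mix S w r)).aestronglyMeasurable
  · rw [Real.norm_eq_abs, abs_of_nonneg (Gint_nonneg h r y)]
    exact Gint_le h r y

lemma Gf_nonneg (h : Good S w) (r : ℝ) : 0 ≤ Gf S w r :=
  integral_nonneg fun y => Gint_nonneg h r y

lemma Gf_le_one (h : Good S w) (r : ℝ) : Gf S w r ≤ 1 := by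
  rw [← integral_mix h r]
  exact integral_mono (integrable_Gint h r) (integrable_mix S w r) fun y => Gint_le h r y

lemma integrable_inp_bar (r : ℝ) (m : V N) :
    Integrable (fun y => inp (bar S w r y) m) (_root_.stdGaussian N) := by
  simp_rw [inp_bar_left]
  exact integrable_finsetSum _ fun x _ => (integrable_lik r x).const_mul _

lemma integral_inp_bar (h : Good S w) (r : ℝ) (m : V N) :
    ∫ y, inp (bar S w r y) m ∂(_root_.stdGaussian N) = inp (mean S w) m := by
  simp_rw [inp_bar_left]
  rw [integral_finsetSum _ fun x _ => (integrable_lik r x).const_mul _, inp_mean_left]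
  refine Finset.sum_congr rfl fun x hx => ?_
  rw [integral_const_mul, integral_lik r x (h.sph x hx), mul_one]

lemma Gf_lower (h : Good S w) (r : ℝ) : inp (mean S w) (mean S w) ≤ Gf S w r := by
  have : ∫ y, (2 * inp (bar S w r y) (mean S w) - inp (mean S w) (mean S w) * mix S w r y)
      ∂(_root_.stdGaussian N) ≤ Gf S w r := by
    refine integral_mono (((integrable_inp_bar r (mean S w)).const_mul 2).sub
      ((integrable_mix S w r).const_mul _)) (integrable_Gint h r) fun y => ?_
    have hp := mix_pos h r y
    have h0 := inp_self_nonneg (bar S w r y + (- mix S w r y) • mean S w)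
    simp only [inp_add_left, inp_add_right, inp_smul_left, inp_smul_right] at h0
    rw [inp_comm' (mean S w) (bar S w r y)] at h0
    simp only
    rw [le_div_iff₀ hp]
    nlinarith
  rw [integral_sub ((integrable_inp_bar r (mean S w)).const_mul 2)
      ((integrable_mix S w r).const_mul _), integral_const_mul, integral_const_mul,
      integral_mix h, integral_inp_bar h] at this
  linarith

lemma good_post (h : Good S w) (r : ℝ) (y : V N) : Good S (post S w r y) := by
  refine ⟨h.sph, fun x hx => ?_, ?_⟩
  · exact div_nonneg (mul_nonneg (h.nonneg x hx) (lik_pos _ _ _).le) (mix_pos h r y).le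
  · unfold post
    rw [← Finset.sum_div]
    exact div_self (mix_pos h r y).ne'

lemma mean_post (r : ℝ) (y : V N) :
    mean S (post S w r y) = (mix S w r y)⁻¹ • bar S w r y := by
  unfold mean post bar
  rw [Finset.smul_sum]
  refine Finset.sum_congr rfl fun x _ => ?_
  rw [smul_smul]; congr 1; ring

lemma mix_mul_mean_post (h : Good S w) (r : ℝ) (y : V N) :
    mix S w r y * inp (mean S (post S w r y)) (mean S (post S w r y)) =
      inp (bar S w r y) (bar S w r y) / mix S w r y := by
  have hp := (mix_pos h r y).ne'
  rw [mean_post, inp_smul_left, inp_smul_right]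
  field_simp

/-- rotation map -/
def rot (ra rd rb : ℝ) (p : V N × V N) : V N := (ra / rb) • p.1 + (rd / rb) • p.2

lemma mp_rot {ra rd rb : ℝ} (hb : 0 < rb) (hr : rb ^ 2 = ra ^ 2 + rd ^ 2) :
    MeasurePreserving (rot (N := N) ra rd rb)
      ((_root_.stdGaussian N).prod (_root_.stdGaussian N)) (_root_.stdGaussian N) := by
  refine map_rot _ _ ?_
  rw [div_pow, div_pow, ← add_div, ← hr]
  exact div_self (by positivity)

lemma lik_rot {ra rd rb : ℝ} (hb : 0 < rb) (hr : rb ^ 2 = ra ^ 2 + rd ^ 2) (x y z : V N) :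
    lik rb x (rot ra rd rb (y, z)) = lik ra x y * lik rd x z := by
  unfold lik rot
  rw [← Real.exp_add, inp_add_right, inp_smul_right, inp_smul_right, hr]
  congr 1
  field_simp
  ring

lemma mix_rot (h : Good S w) {ra rd rb : ℝ} (hb : 0 < rb) (hr : rb ^ 2 = ra ^ 2 + rd ^ 2)
    (y z : V N) :
    mix S w rb (rot ra rd rb (y, z)) = mix S w ra y * mix S (post S w ra y) rd z := by
  have hp := (mix_pos h ra y).ne'
  conv_lhs => unfold mix
  conv_rhs => rw [mix.eq_1 S (post S w ra y)]
  rw [Finset.mul_sum]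
  refine Finset.sum_congr rfl fun x _ => ?_
  rw [lik_rot hb hr]
  unfold post
  field_simp

lemma bar_rot (h : Good S w) {ra rd rb : ℝ} (hb : 0 < rb) (hr : rb ^ 2 = ra ^ 2 + rd ^ 2)
    (y z : V N) :
    bar S w rb (rot ra rd rb (y, z)) = mix S w ra y • bar S (post S w ra y) rd z := by
  have hp := (mix_pos h ra y).ne'
  unfold bar
  rw [Finset.smul_sum]
  refine Finset.sum_congr rfl fun x _ => ?_
  rw [lik_rot hb hr, smul_smul]
  congr 1
  unfold post
  field_simp

lemma KLf_rot (h : Good S w) {ra rd rb : ℝ} (hb : 0 < rb) (hr : rb ^ 2 = ra ^ 2 + rd ^ 2) :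
    Integrable (fun y => mix S w ra y * Real.log (mix S w ra y) +
      mix S w ra y * KLf S (post S w ra y) rd) (_root_.stdGaussian N) ∧
    KLf S w rb = ∫ y, (mix S w ra y * Real.log (mix S w ra y) +
      mix S w ra y * KLf S (post S w ra y) rd) ∂(_root_.stdGaussian N) := by
  have mp := mp_rot (N := N) hb hr
  have hi := (integrable_mix_log h rb)
  have hi2 := (mp.integrable_comp hi.aestronglyMeasurable).2 hi
  have inner : ∀ y, ∫ z, ((fun y => mix S w rb y * Real.log (mix S w rb y)) ∘ rot ra rd rb) (y, z)
      ∂(_root_.stdGaussian N) = mix S w ra y * Real.log (mix S w ra y) +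
      mix S w ra y * KLf S (post S w ra y) rd := by
    intro y
    have hg := good_post h ra y
    have e : ∀ z, ((fun y => mix S w rb y * Real.log (mix S w rb y)) ∘ rot ra rd rb) (y, z) =
        (mix S w ra y * Real.log (mix S w ra y)) * mix S (post S w ra y) rd z +
        mix S w ra y * (mix S (post S w ra y) rd z * Real.log (mix S (post S w ra y) rd z)) := by
      intro z
      simp only [Function.comp]
      rw [mix_rot h hb hr, Real.log_mul (mix_pos h ra y).ne' (mix_pos hg rd z).ne']
      ring
    simp_rw [e]
    rw [integral_add ((integrable_mix _ _ _).const_mul _) ((integrable_mix_log hg rd).const_mul _),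
      integral_const_mul, integral_const_mul, integral_mix hg, mul_one]
    rfl
  constructor
  · refine hi2.integral_prod_left.congr (ae_of_all _ fun y => ?_)
    exact inner y
  · have e0 := integral_map (μ := (_root_.stdGaussian N).prod (_root_.stdGaussian N))
      mp.measurable.aemeasurable (by rw [mp.map_eq]; exact hi.aestronglyMeasurable)
    rw [mp.map_eq] at e0
    have := integral_prod _ hi2
    simp_rw [inner] at this
    exact e0.trans this

lemma Gf_rot (h : Good S w) {ra rd rb : ℝ} (hb : 0 < rb) (hr : rb ^ 2 = ra ^ 2 + rd ^ 2) :
    Integrable (fun y => mix S w ra y * Gf S (post S w ra y) rd) (_root_.stdGaussian N) ∧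
    Gf S w rb = ∫ y, mix S w ra y * Gf S (post S w ra y) rd ∂(_root_.stdGaussian N) := by
  have mp := mp_rot (N := N) hb hr
  have hi := (integrable_Gint h rb)
  have hi2 := (mp.integrable_comp hi.aestronglyMeasurable).2 hi
  have inner : ∀ y, ∫ z, ((fun y => inp (bar S w rb y) (bar S w rb y) / mix S w rb y)
      ∘ rot ra rd rb) (y, z)
      ∂(_root_.stdGaussian N) = mix S w ra y * Gf S (post S w ra y) rd := by
    intro y
    have hg := good_post h ra y
    have hp := (mix_pos h ra y).ne'
    have e : ∀ z, ((fun y => inp (bar S w rb y) (bar S w rb y) / mix S w rb y)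
        ∘ rot ra rd rb) (y, z) =
        mix S w ra y * (inp (bar S (post S w ra y) rd z) (bar S (post S w ra y) rd z) /
          mix S (post S w ra y) rd z) := by
      intro z
      have hp' := (mix_pos hg rd z).ne'
      simp only [Function.comp]
      rw [mix_rot h hb hr, bar_rot h hb hr, inp_smul_left, inp_smul_right]
      field_simp
    simp_rw [e]
    rw [integral_const_mul]
    rfl
  constructor
  · refine hi2.integral_prod_left.congr (ae_of_all _ fun y => ?_)
    exact inner y
  · have e0 := integral_map (μ := (_root_.stdGaussian N).prod (_root_.stdGaussian N))
      mp.measurable.aemeasurable (by rw [mp.map_eq]; exact hi.aestronglyMeasurable)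
    rw [mp.map_eq] at e0
    have := integral_prod _ hi2
    simp_rw [inner] at this
    exact e0.trans this

lemma Gf_mono (h : Good S w) {ra rd rb : ℝ} (hb : 0 < rb) (hr : rb ^ 2 = ra ^ 2 + rd ^ 2) :
    Gf S w ra ≤ Gf S w rb := by
  obtain ⟨i, e⟩ := Gf_rot h hb hr
  rw [e]
  refine integral_mono (integrable_Gint h ra) i fun y => ?_
  simp only
  rw [← mix_mul_mean_post h]
  exact mul_le_mul_of_nonneg_left (Gf_lower (good_post h ra y) rd) (mix_pos h ra y).le

lemma KLf_step_lower (h : Good S w) {ra rd rb : ℝ} (hb : 0 < rb) (hr : rb ^ 2 = ra ^ 2 + rd ^ 2) :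
    KLf S w ra + rd ^ 2 / 2 * Gf S w ra ≤ KLf S w rb := by
  obtain ⟨i, e⟩ := KLf_rot h hb hr
  rw [e]
  unfold KLf Gf
  rw [← integral_const_mul, ← integral_add (integrable_mix_log h ra)
    ((integrable_Gint h ra).const_mul _)]
  refine integral_mono ((integrable_mix_log h ra).add ((integrable_Gint h ra).const_mul _)) i
    fun y => ?_
  simp only
  rw [← mix_mul_mean_post h]
  have := mul_le_mul_of_nonneg_left (KLf_lower (good_post h ra y) rd) (mix_pos h ra y).le
  unfold KLf at this
  linarith

lemma KLf_step_upper (h : Good S w) {ra rd rb : ℝ} (hb : 0 < rb) (hr : rb ^ 2 = ra ^ 2 + rd ^ 2)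
    (hd : rd ^ 2 ≤ 1 / 4) :
    KLf S w rb ≤ KLf S w ra + rd ^ 2 / 2 * Gf S w ra + 16 * rd ^ 4 := by
  obtain ⟨i, e⟩ := KLf_rot h hb hr
  have : KLf S w rb ≤ ∫ y, (mix S w ra y * Real.log (mix S w ra y) + (rd ^ 2 / 2 *
      (inp (bar S w ra y) (bar S w ra y) / mix S w ra y) + 16 * rd ^ 4 * mix S w ra y))
      ∂(_root_.stdGaussian N) := by
    rw [e]
    refine integral_mono i ((integrable_mix_log h ra).add
      (((integrable_Gint h ra).const_mul _).add ((integrable_mix S w ra).const_mul _))) fun y => ?_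
    simp only
    rw [← mix_mul_mean_post h]
    have := mul_le_mul_of_nonneg_left (KLf_upper (good_post h ra y) rd hd) (mix_pos h ra y).le
    linarith
  have j : Integrable (fun y => rd ^ 2 / 2 *
      (inp (bar S w ra y) (bar S w ra y) / mix S w ra y) + 16 * rd ^ 4 * mix S w ra y)
      (_root_.stdGaussian N) :=
    ((integrable_Gint h ra).const_mul _).add ((integrable_mix S w ra).const_mul _)
  rw [integral_add (integrable_mix_log h ra) j, integral_add ((integrable_Gint h ra).const_mul _)
    ((integrable_mix S w ra).const_mul _), integral_const_mul, integral_const_mul,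
    integral_mix h] at this
  unfold KLf Gf at *
  linarith

/-- In terms of the SNR. -/
lemma Gl_mono (h : Good S w) {a b : ℝ} (ha : 0 ≤ a) (hab : a < b) :
    Gf S w (√a) ≤ Gf S w (√b) := by
  refine Gf_mono h (rd := √(b - a)) (Real.sqrt_pos.2 (ha.trans_lt hab)) ?_
  rw [Real.sq_sqrt ha, Real.sq_sqrt (by linarith), Real.sq_sqrt (by linarith)]; ring

lemma Dl_lower (h : Good S w) {a b : ℝ} (ha : 0 ≤ a) (hab : a < b) :
    KLf S w (√a) + (b - a) / 2 * Gf S w (√a) ≤ KLf S w (√b) := by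
  have := KLf_step_lower h (ra := √a) (rd := √(b - a)) (Real.sqrt_pos.2 (ha.trans_lt hab)) (by
    rw [Real.sq_sqrt ha, Real.sq_sqrt (by linarith), Real.sq_sqrt (by linarith)]; ring)
  rwa [Real.sq_sqrt (by linarith)] at this

lemma Dl_mono (h : Good S w) {a b : ℝ} (ha : 0 ≤ a) (hab : a ≤ b) :
    KLf S w (√a) ≤ KLf S w (√b) := by
  rcases hab.eq_or_lt with rfl | hab
  · exact le_rfl
  have h1 := Dl_lower h ha hab
  have h2 := mul_nonneg (show 0 ≤ (b - a) / 2 by linarith) (Gf_nonneg h (√a))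
  linarith

lemma Dl_step (h : Good S w) {a b : ℝ} (ha : 0 ≤ a) (hab : a < b) (hd : b - a ≤ 1 / 4) :
    KLf S w (√b) ≤ KLf S w (√a) + (b - a) / 2 * Gf S w (√a) + 16 * (b - a) ^ 2 := by
  have := KLf_step_upper h (ra := √a) (rd := √(b - a)) (Real.sqrt_pos.2 (ha.trans_lt hab)) (by
    rw [Real.sq_sqrt ha, Real.sq_sqrt (by linarith), Real.sq_sqrt (by linarith)]; ring)
    (by rw [Real.sq_sqrt (by linarith)]; exact hd)
  rwa [show √(b - a) ^ 4 = (√(b - a) ^ 2) ^ 2 by ring, Real.sq_sqrt (by linarith)] at this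

lemma Dl_upper (h : Good S w) {a b : ℝ} (ha : 0 ≤ a) (hab : a < b) :
    KLf S w (√b) ≤ KLf S w (√a) + (b - a) / 2 * Gf S w (√b) := by
  have key : ∀ n : ℕ, 4 * (b - a) ≤ n → KLf S w (√b) ≤
      KLf S w (√a) + (b - a) / 2 * Gf S w (√b) + 16 * (b - a) ^ 2 / n := by
    intro n hn
    have hn0 : (0 : ℝ) < n := by linarith
    set δ := (b - a) / n with hδ
    have hδ0 : 0 < δ := div_pos (by linarith) hn0
    have hδ4 : δ ≤ 1 / 4 := by rw [hδ, div_le_iff₀ hn0]; linarith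
    have hnδ : n * δ = b - a := by rw [hδ]; field_simp
    have ind : ∀ k : ℕ, k ≤ n → KLf S w (√(a + k * δ)) ≤
        KLf S w (√a) + k * (δ / 2 * Gf S w (√b) + 16 * δ ^ 2) := by
      intro k
      induction k with
      | zero => intro _; simp
      | succ k ih =>
        intro hk
        have h1 := ih (by omega)
        have hk' : ((k : ℝ) + 1) ≤ n := by exact_mod_cast hk
        have hk0 : (0 : ℝ) ≤ k := Nat.cast_nonneg k
        have hlt : a + k * δ < b := by nlinarith
        have h2 := Dl_step h (a := a + k * δ) (b := a + (k + 1) * δ) (by positivity)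
          (by nlinarith) (by nlinarith)
        have h3 := Gl_mono h (a := a + k * δ) (b := b) (by positivity) hlt
        rw [show a + (k + 1) * δ - (a + k * δ) = δ by ring] at h2
        have h4 := mul_le_mul_of_nonneg_left h3 (show 0 ≤ δ / 2 by positivity)
        push_cast
        linarith
    have h5 := ind n le_rfl
    rw [hnδ, show a + (b - a) = b by ring] at h5
    have e1 : (n : ℝ) * (δ / 2 * Gf S w (√b) + 16 * δ ^ 2) =
        (b - a) / 2 * Gf S w (√b) + 16 * (b - a) ^ 2 / n := by
      rw [← hnδ]; field_simp
    rw [e1] at h5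
    linarith
  have lim : Tendsto (fun n : ℕ => KLf S w (√a) + (b - a) / 2 * Gf S w (√b) +
      16 * (b - a) ^ 2 / n) atTop (nhds (KLf S w (√a) + (b - a) / 2 * Gf S w (√b) + 0)) :=
    tendsto_const_nhds.add (tendsto_const_div_atTop_nhds_zero_nat _)
  rw [add_zero] at lim
  refine ge_of_tendsto lim ?_
  obtain ⟨n0, hn0⟩ := exists_nat_ge (4 * (b - a))
  filter_upwards [eventually_ge_atTop n0] with n hn
  exact key n (hn0.trans (by exact_mod_cast hn))

end


/-- uniform weights -/
def uw {N : ℕ} (S : Finset (V N)) : V N → ℝ := fun _ => (S.card : ℝ)⁻¹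

section
variable {N : ℕ} {S : Finset (V N)}

lemma good_uw (hS : onSphere S) (hne : S.Nonempty) : Good S (uw S) := by
  have hc : (S.card : ℝ) ≠ 0 := by exact_mod_cast hne.card_pos.ne'
  refine ⟨fun x hx => ?_, fun x _ => by unfold uw; positivity, ?_⟩
  · rw [← hS x hx]; unfold inp
    exact Finset.sum_congr rfl fun i _ => by ring
  · simp [uw, hc]

lemma log_lik (r : ℝ) (x y : V N) : Real.log (lik r x y) = r * inp x y - r ^ 2 / 2 := by
  unfold lik; rw [Real.log_exp]

lemma integrable_lik_log (r : ℝ) (x : V N) :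
    Integrable (fun y => lik r x y * Real.log (lik r x y)) (_root_.stdGaussian N) := by
  refine (((integrable_inp_lik r x x).const_mul r).sub
    ((integrable_lik r x).const_mul (r ^ 2 / 2))).congr (ae_of_all _ fun y => ?_)
  simp only [log_lik, Pi.sub_apply]; ring

lemma integral_lik_log (r : ℝ) (x : V N) (hx : inp x x = 1) :
    ∫ y, lik r x y * Real.log (lik r x y) ∂(_root_.stdGaussian N) = r ^ 2 / 2 := by
  have e : ∀ y, lik r x y * Real.log (lik r x y) =
      r * (inp x y * lik r x y) - r ^ 2 / 2 * lik r x y := by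
    intro y; rw [log_lik]; ring
  simp_rw [e]
  rw [integral_sub ((integrable_inp_lik r x x).const_mul r)
    ((integrable_lik r x).const_mul (r ^ 2 / 2)), integral_const_mul, integral_const_mul,
    integral_inp_lik r x x hx, integral_lik r x hx, hx]
  ring

/-- Average of the log-likelihood under the joint law. -/
def Afun (S : Finset (V N)) (w : V N → ℝ) (r : ℝ) (y : V N) : ℝ :=
  ∑ x ∈ S, w x * (lik r x y * Real.log (lik r x y))

lemma integrable_Afun (S : Finset (V N)) (w : V N → ℝ) (r : ℝ) :
    Integrable (Afun S w r) (_root_.stdGaussian N) := by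
  unfold Afun
  exact integrable_finsetSum _ fun x _ => (integrable_lik_log r x).const_mul _

lemma integral_Afun {w : V N → ℝ} (h : Good S w) (r : ℝ) :
    ∫ y, Afun S w r y ∂(_root_.stdGaussian N) = r ^ 2 / 2 := by
  unfold Afun
  rw [integral_finsetSum _ fun x _ => (integrable_lik_log r x).const_mul _,
    ← one_mul (r ^ 2 / 2), ← h.sum, Finset.sum_mul]
  refine Finset.sum_congr rfl fun x hx => ?_
  rw [integral_const_mul, integral_lik_log r x (h.sph x hx)]

lemma KLf_ge (hS : onSphere S) (hne : S.Nonempty) (r : ℝ) :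
    r ^ 2 / 2 - Real.log S.card ≤ KLf S (uw S) r := by
  have h := good_uw hS hne
  have hc : (0 : ℝ) < S.card := by exact_mod_cast hne.card_pos
  have : ∫ y, (Afun S (uw S) r y - Real.log S.card * mix S (uw S) r y) ∂(_root_.stdGaussian N)
      ≤ KLf S (uw S) r := by
    refine integral_mono ((integrable_Afun S _ r).sub ((integrable_mix S _ r).const_mul _))
      (integrable_mix_log h r) fun y => ?_
    simp only
    have hp := mix_pos h r y
    conv_rhs => rw [mix.eq_1, Finset.sum_mul]
    rw [mix.eq_1, Afun, Finset.mul_sum, ← Finset.sum_sub_distrib]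
    refine Finset.sum_le_sum fun x hx => ?_
    have hl := lik_pos r x y
    have h1 : (S.card : ℝ)⁻¹ * lik r x y ≤ mix S (uw S) r y :=
      Finset.single_le_sum (f := fun x => uw S x * lik r x y)
        (fun x hx => mul_nonneg (h.nonneg x hx) (lik_pos _ _ _).le) hx
    have h2 := Real.log_le_log (by positivity) h1
    rw [Real.log_mul (by positivity) hl.ne', Real.log_inv] at h2
    have h3 : 0 ≤ uw S x * lik r x y := mul_nonneg (h.nonneg x hx) hl.le
    have := mul_le_mul_of_nonneg_left h2 h3
    unfold mix at this
    linarith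
  rw [integral_sub (integrable_Afun S _ r) ((integrable_mix S _ r).const_mul _),
    integral_const_mul, integral_mix h, integral_Afun h] at this
  linarith

/-- Gibbs inequality. -/
lemma gibbs {ι : Type*} (s : Finset ι) (p K : ι → ℝ) (hp : ∀ i ∈ s, 0 < p i)
    (hK : ∀ i ∈ s, 0 < K i) (hsum : ∑ i ∈ s, p i = 1) (hKs : ∑ i ∈ s, K i ≤ 1) :
    ∑ i ∈ s, p i * Real.log (K i) ≤ ∑ i ∈ s, p i * Real.log (p i) := by
  have : ∑ i ∈ s, (p i * Real.log (K i) - p i * Real.log (p i)) ≤ ∑ i ∈ s, (K i - p i) := by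
    refine Finset.sum_le_sum fun i hi => ?_
    have h1 := Real.log_le_sub_one_of_pos (div_pos (hK i hi) (hp i hi))
    rw [Real.log_div (hK i hi).ne' (hp i hi).ne'] at h1
    have h2 := mul_le_mul_of_nonneg_left h1 (hp i hi).le
    have e : p i * (K i / p i - 1) = K i - p i := by
      have := (hp i hi).ne'
      field_simp
    rw [e] at h2
    linarith
  rw [Finset.sum_sub_distrib, Finset.sum_sub_distrib] at this
  linarith

open Classical in
/-- overlap indicator -/
def ovl (t : ℝ) (x x' : V N) : ℝ := if t ≤ inp x x' then 1 else 0

/-- local partition function -/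
def Zf (S : Finset (V N)) (t l : ℝ) (x' : V N) : ℝ := ∑ x ∈ S, Real.exp (l * ovl t x' x)

lemma ovl_ge {t : ℝ} (ht : t < 1) {x x' : V N} (hx : inp x x' ≤ 1) :
    1 - (1 - inp x x') / (1 - t) ≤ ovl t x x' := by
  unfold ovl
  have h1 : 0 < 1 - t := by linarith
  split_ifs with h
  · have : 0 ≤ (1 - inp x x') / (1 - t) := div_nonneg (by linarith) h1.le
    linarith
  · have : 1 ≤ (1 - inp x x') / (1 - t) := by rw [le_div_iff₀ h1]; linarith
    linarith

lemma entropy_post {w : V N → ℝ} (h : Good S w) (hw : ∀ x ∈ S, 0 < w x) (hne : S.Nonempty)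
    {t l : ℝ} (ht : t < 1) (hl : 0 ≤ l) :
    l * (1 - (1 - inp (mean S w) (mean S w)) / (1 - t)) - ∑ x' ∈ S, w x' * Real.log (Zf S t l x')
      ≤ ∑ x ∈ S, w x * Real.log (w x) := by
  have hZ : ∀ x', 0 < Zf S t l x' := fun x' => Finset.sum_pos (fun x _ => Real.exp_pos _) hne
  have h1 : ∀ x' ∈ S, ∑ x ∈ S, w x * (l * ovl t x' x) - Real.log (Zf S t l x')
      ≤ ∑ x ∈ S, w x * Real.log (w x) := by
    intro x' _
    have := gibbs S w (fun x => Real.exp (l * ovl t x' x) / Zf S t l x') hw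
      (fun x _ => div_pos (Real.exp_pos _) (hZ x')) h.sum
      (by rw [← Finset.sum_div]; exact (div_self (hZ x').ne').le)
    refine le_trans (le_of_eq ?_) this
    simp_rw [Real.log_div (Real.exp_pos _).ne' (hZ x').ne', Real.log_exp, mul_sub,
      Finset.sum_sub_distrib, ← Finset.sum_mul, h.sum, one_mul]
  have h2 : ∑ x' ∈ S, w x' * (∑ x ∈ S, w x * (l * ovl t x' x) - Real.log (Zf S t l x')) ≤
      ∑ x' ∈ S, w x' * (∑ x ∈ S, w x * Real.log (w x)) :=
    Finset.sum_le_sum fun x' hx' => mul_le_mul_of_nonneg_left (h1 x' hx') (h.nonneg x' hx')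
  rw [← Finset.sum_mul, h.sum, one_mul] at h2
  refine le_trans ?_ h2
  simp_rw [mul_sub, Finset.sum_sub_distrib]
  refine sub_le_sub_right ?_ _
  have e : l * 1 - l * ((1 - inp (mean S w) (mean S w)) / (1 - t)) =
      ∑ x' ∈ S, w x' * ∑ x ∈ S, w x * (l * (1 - (1 - inp x' x) / (1 - t))) := by
    have e1 : ∀ x' ∈ S, ∑ x ∈ S, w x * (l * (1 - (1 - inp x' x) / (1 - t))) =
        (l - l / (1 - t)) + l / (1 - t) * inp x' (mean S w) := by
      intro x' _
      have e0 : l - l / (1 - t) = ∑ x ∈ S, w x * (l - l / (1 - t)) := by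
        rw [← Finset.sum_mul, h.sum, one_mul]
      rw [inp_mean_right, Finset.mul_sum, e0, ← Finset.sum_add_distrib]
      exact Finset.sum_congr rfl fun x _ => by ring
    rw [Finset.sum_congr rfl fun x' hx' => by rw [e1 x' hx']]
    simp_rw [mul_add, Finset.sum_add_distrib, ← Finset.sum_mul, h.sum]
    have e2 : ∑ x' ∈ S, w x' * (l / (1 - t) * inp x' (mean S w)) =
        l / (1 - t) * inp (mean S w) (mean S w) := by
      rw [inp_mean_left, Finset.mul_sum]
      exact Finset.sum_congr rfl fun x _ => by ring
    rw [e2]; ring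
  rw [e]
  refine Finset.sum_le_sum fun x' hx' => mul_le_mul_of_nonneg_left ?_ (h.nonneg x' hx')
  refine Finset.sum_le_sum fun x hx => mul_le_mul_of_nonneg_left ?_ (h.nonneg x hx)
  exact mul_le_mul_of_nonneg_left (ovl_ge ht (abs_le.1 (abs_inp_le_one h hx' hx)).2) hl

lemma KLf_le (hS : onSphere S) (hne : S.Nonempty) (r : ℝ) {t l : ℝ} (ht : t < 1) (hl : 0 ≤ l)
    (hq : Real.exp l * (∑ x ∈ S, ∑ x' ∈ S, ovl t x x') ≤ (S.card : ℝ) ^ 2) :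
    KLf S (uw S) r ≤ r ^ 2 / 2 + Real.log 2 - l * (1 - (1 - Gf S (uw S) r) / (1 - t)) := by
  have h := good_uw hS hne
  have hc : (0 : ℝ) < S.card := by exact_mod_cast hne.card_pos
  set L := Real.log S.card with hL
  have hw : ∀ x ∈ S, 0 < uw S x := fun x _ => by unfold uw; positivity
  have hZ : ∀ x', 0 < Zf S t l x' := fun x' => Finset.sum_pos (fun x _ => Real.exp_pos _) hne
  -- the average of the log partition functions
  have hlogZ : ∑ x ∈ S, uw S x * Real.log (Zf S t l x) ≤ Real.log 2 + L := by
    have hZs : ∑ x ∈ S, Zf S t l x ≤ 2 * (S.card : ℝ) ^ 2 := by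
      have : ∑ x ∈ S, Zf S t l x ≤ ∑ x ∈ S, ∑ x' ∈ S, (1 + Real.exp l * ovl t x x') := by
        refine Finset.sum_le_sum fun x _ => Finset.sum_le_sum fun x' _ => ?_
        unfold ovl
        split_ifs
        · simp
        · simp
      refine this.trans ?_
      simp_rw [Finset.sum_add_distrib, ← Finset.mul_sum]
      simp only [Finset.sum_const, nsmul_eq_mul, mul_one]
      nlinarith
    have h2c : (0 : ℝ) < 2 * S.card := by positivity
    have : ∑ x ∈ S, uw S x * Real.log (Zf S t l x) ≤
        ∑ x ∈ S, uw S x * ((Real.log 2 + L - 1) + (2 * (S.card : ℝ))⁻¹ * Zf S t l x) := by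
      refine Finset.sum_le_sum fun x hx => mul_le_mul_of_nonneg_left ?_ (hw x hx).le
      have := Real.log_le_sub_one_of_pos (div_pos (hZ x) h2c)
      rw [Real.log_div (hZ x).ne' h2c.ne', Real.log_mul two_ne_zero hc.ne'] at this
      rw [inv_mul_eq_div]
      linarith
    refine this.trans ?_
    simp_rw [mul_add, Finset.sum_add_distrib, ← Finset.sum_mul, h.sum]
    have e : ∑ x ∈ S, uw S x * ((2 * (S.card : ℝ))⁻¹ * Zf S t l x) =
        (2 * (S.card : ℝ) ^ 2)⁻¹ * ∑ x ∈ S, Zf S t l x := by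
      rw [Finset.mul_sum]
      refine Finset.sum_congr rfl fun x _ => ?_
      unfold uw; field_simp
    rw [e]
    have : (2 * (S.card : ℝ) ^ 2)⁻¹ * ∑ x ∈ S, Zf S t l x ≤ 1 := by
      rw [inv_mul_le_iff₀ (by positivity)]; linarith
    linarith
  -- pointwise bound
  set B : V N → ℝ := fun y => ∑ x ∈ S, (uw S x * Real.log (Zf S t l x)) * lik r x y with hB
  have iB : Integrable B (_root_.stdGaussian N) :=
    integrable_finsetSum _ fun x _ => (integrable_lik r x).const_mul _
  have eB : ∫ y, B y ∂(_root_.stdGaussian N) = ∑ x ∈ S, uw S x * Real.log (Zf S t l x) := by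
    rw [hB, integral_finsetSum _ fun x _ => (integrable_lik r x).const_mul _]
    refine Finset.sum_congr rfl fun x hx => ?_
    rw [integral_const_mul, integral_lik r x (h.sph x hx), mul_one]
  have pt : ∀ y, mix S (uw S) r y * Real.log (mix S (uw S) r y) ≤
      (Afun S (uw S) r y - (L + l * (1 - 1 / (1 - t))) * mix S (uw S) r y) +
      (B y - l / (1 - t) * (inp (bar S (uw S) r y) (bar S (uw S) r y) / mix S (uw S) r y)) := by
    intro y
    have hp := mix_pos h r y
    have hg := good_post h r y
    have hpw : ∀ x ∈ S, 0 < post S (uw S) r y x := fun x hx =>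
      div_pos (mul_pos (hw x hx) (lik_pos _ _ _)) hp
    have hent := entropy_post hg hpw hne ht hl
    have hent := mul_le_mul_of_nonneg_left hent hp.le
    rw [← mix_mul_mean_post h]
    have e1 : mix S (uw S) r y * ∑ x ∈ S, post S (uw S) r y x * Real.log (post S (uw S) r y x) =
        Afun S (uw S) r y - L * mix S (uw S) r y
          - mix S (uw S) r y * Real.log (mix S (uw S) r y) := by
      have : mix S (uw S) r y * Real.log (mix S (uw S) r y) =
        ∑ x ∈ S, uw S x * lik r x y * Real.log (mix S (uw S) r y) := by
        rw [← Finset.sum_mul]; rfl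
      rw [this]
      have : L * mix S (uw S) r y = ∑ x ∈ S, L * (uw S x * lik r x y) := by
        rw [← Finset.mul_sum]; rfl
      rw [this, Afun, Finset.mul_sum, ← Finset.sum_sub_distrib, ← Finset.sum_sub_distrib]
      refine Finset.sum_congr rfl fun x hx => ?_
      have hpost : Real.log (post S (uw S) r y x) =
          -L + Real.log (lik r x y) - Real.log (mix S (uw S) r y) := by
        unfold post
        rw [Real.log_div (mul_pos (hw x hx) (lik_pos _ _ _)).ne' hp.ne',
          Real.log_mul (hw x hx).ne' (lik_pos _ _ _).ne', uw, Real.log_inv]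
      rw [hpost]
      unfold post
      field_simp
      ring
    have e2 : mix S (uw S) r y * ∑ x' ∈ S, post S (uw S) r y x' * Real.log (Zf S t l x') = B y := by
      rw [hB, Finset.mul_sum]
      refine Finset.sum_congr rfl fun x hx => ?_
      unfold post
      field_simp
    rw [e1, mul_sub, e2] at hent
    have e3 : mix S (uw S) r y * (l * (1 - (1 - inp (mean S (post S (uw S) r y))
        (mean S (post S (uw S) r y))) / (1 - t))) = l * (1 - 1 / (1 - t)) * mix S (uw S) r y +
        l / (1 - t) * (mix S (uw S) r y * inp (mean S (post S (uw S) r y))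
        (mean S (post S (uw S) r y))) := by ring
    rw [e3] at hent
    linarith
  have j1 : Integrable (fun y => Afun S (uw S) r y -
      (L + l * (1 - 1 / (1 - t))) * mix S (uw S) r y) (_root_.stdGaussian N) :=
    (integrable_Afun S _ r).sub ((integrable_mix S _ r).const_mul _)
  have j2 : Integrable (fun y => B y - l / (1 - t) * (inp (bar S (uw S) r y) (bar S (uw S) r y)
      / mix S (uw S) r y)) (_root_.stdGaussian N) :=
    iB.sub ((integrable_Gint h r).const_mul _)
  have fin := integral_mono (integrable_mix_log h r) (j1.add j2) pt
  have fin2 : KLf S (uw S) r ≤ r ^ 2 / 2 - (L + l * (1 - 1 / (1 - t))) * 1 +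
      (∑ x ∈ S, uw S x * Real.log (Zf S t l x) - l / (1 - t) * Gf S (uw S) r) := by
    refine fin.trans (le_of_eq ?_)
    rw [integral_add' j1 j2, integral_sub (integrable_Afun S _ r)
      ((integrable_mix S _ r).const_mul _), integral_sub iB ((integrable_Gint h r).const_mul _),
      integral_const_mul, integral_const_mul, integral_Afun h, integral_mix h, eB]
    rfl
  refine fin2.trans ?_
  have : l * (1 - (1 - Gf S (uw S) r) / (1 - t)) = l * (1 - 1 / (1 - t)) +
    l / (1 - t) * Gf S (uw S) r := by ring
  rw [this]
  linarith
end


section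
variable {N : ℕ} {S : Finset (V N)}

lemma lintegral_unifOn (S : Finset (V N)) (f : V N → ℝ≥0∞) :
    ∫⁻ x, f x ∂(unifOn S) = (S.card : ℝ≥0∞)⁻¹ * ∑ x ∈ S, f x := by
  unfold unifOn
  rw [lintegral_smul_measure, lintegral_finsetSum_measure]
  simp

instance sfinite_unifOn (S : Finset (V N)) : SFinite (unifOn S) := by
  unfold unifOn; infer_instance

/-- The conditional law of `Y`. -/
def likM (r : ℝ) (x : V N) : Measure (V N) :=
  (_root_.stdGaussian N).withDensity (fun y => ENNReal.ofReal (lik r x y))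

lemma likM_eq (r : ℝ) (x : V N) (hx : inp x x = 1) :
    likM r x = (_root_.stdGaussian N).map (fun z => r • x + z) := by
  rw [map_shift, likM]
  simp_rw [lik_eq r x _ hx]

lemma measurable_mk (x : V N) : Measurable (fun y : V N => (x, y)) := measurable_prodMk_left

lemma jointLaw_eq (hS : onSphere S) (hne : S.Nonempty) (lam : ℝ) :
    jointLaw N S lam = (S.card : ℝ≥0∞)⁻¹ • ∑ x ∈ S, (likM (√lam) x).map (fun y => (x, y)) := by
  have h := good_uw hS hne
  have hm : Measurable (fun q : V N × V N => (q.1, fun i => Real.sqrt lam * q.1 i + q.2 i)) := by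
    fun_prop
  ext A hA
  unfold jointLaw
  rw [Measure.map_apply hm hA, Measure.prod_apply (hm hA), lintegral_unifOn]
  simp only [Measure.smul_apply, Measure.finsetSum_apply, smul_eq_mul]
  congr 1
  refine Finset.sum_congr rfl fun x hx => ?_
  rw [likM_eq _ _ (h.sph x hx), Measure.map_map (measurable_mk x) (by fun_prop),
    Measure.map_apply ((measurable_mk x).comp (by fun_prop)) hA]
  rfl

lemma Q_eq (hS : onSphere S) (hne : S.Nonempty) (lam : ℝ) :
    Q N S lam = (_root_.stdGaussian N).withDensity
      (fun y => ENNReal.ofReal (mix S (uw S) (√lam) y)) := by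
  have hc : (0 : ℝ) < S.card := by exact_mod_cast hne.card_pos
  ext A hA
  unfold Q
  rw [jointLaw_eq hS hne, Measure.map_apply measurable_snd hA, withDensity_apply _ hA]
  simp only [Measure.smul_apply, Measure.finsetSum_apply, smul_eq_mul]
  have e : ∀ y, ENNReal.ofReal (mix S (uw S) (√lam) y) =
      (S.card : ℝ≥0∞)⁻¹ * ∑ x ∈ S, ENNReal.ofReal (lik (√lam) x y) := by
    intro y
    unfold mix uw
    rw [← Finset.mul_sum, ENNReal.ofReal_mul (by positivity),
      ENNReal.ofReal_sum_of_nonneg (fun x _ => (lik_pos _ _ _).le), ENNReal.ofReal_inv_of_pos hc,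
      ENNReal.ofReal_natCast]
  simp_rw [e]
  have hml : ∀ x : V N, Measurable (fun y => ENNReal.ofReal (lik (√lam) x y)) := fun x =>
    (measurable_lik _ x).ennreal_ofReal
  rw [lintegral_const_mul _ (Finset.measurable_sum _ fun x _ => hml x),
    lintegral_finsetSum _ (fun x _ => hml x)]
  congr 1
  refine Finset.sum_congr rfl fun x _ => ?_
  rw [Measure.map_apply (measurable_mk x) (measurable_snd hA), likM]
  exact withDensity_apply _ hA

lemma Q_zero (hS : onSphere S) (hne : S.Nonempty) :
    Q N S 0 = _root_.stdGaussian N := by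
  have h := good_uw hS hne
  rw [Q_eq hS hne]
  have : ∀ y, mix S (uw S) (√0) y = 1 := by
    intro y
    rw [← h.sum]
    unfold mix lik
    simp
  simp_rw [this, ENNReal.ofReal_one]
  exact withDensity_one

lemma kl_eq (hS : onSphere S) (hne : S.Nonempty) (lam : ℝ) :
    klReal (Q N S lam) (Q N S 0) = KLf S (uw S) (√lam) := by
  have h := good_uw hS hne
  have hm : Measurable (fun y => ENNReal.ofReal (mix S (uw S) (√lam) y)) :=
    (measurable_mix S _ _).ennreal_ofReal
  rw [Q_zero hS hne, Q_eq hS hne]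
  unfold klReal
  have h1 := Measure.rnDeriv_withDensity (_root_.stdGaussian N) hm
  have h2 := (withDensity_absolutelyContinuous (_root_.stdGaussian N)
    (fun y => ENNReal.ofReal (mix S (uw S) (√lam) y))).ae_le h1
  have h3 : ∫ y, Real.log (((_root_.stdGaussian N).withDensity
      (fun y => ENNReal.ofReal (mix S (uw S) (√lam) y))).rnDeriv (_root_.stdGaussian N) y).toReal
      ∂((_root_.stdGaussian N).withDensity
      (fun y => ENNReal.ofReal (mix S (uw S) (√lam) y))) =
      ∫ y, Real.log (mix S (uw S) (√lam) y) ∂((_root_.stdGaussian N).withDensity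
      (fun y => ENNReal.ofReal (mix S (uw S) (√lam) y))) := by
    refine integral_congr_ae ?_
    filter_upwards [h2] with y hy
    rw [hy, ENNReal.toReal_ofReal (mix_pos h _ y).le]
  rw [h3, integral_withDensity_eq_integral_toReal_smul hm (by simp)]
  unfold KLf
  refine integral_congr_ae (ae_of_all _ fun y => ?_)
  simp [ENNReal.toReal_ofReal (mix_pos h _ y).le]

lemma integral_joint (hS : onSphere S) (hne : S.Nonempty) (lam : ℝ) (φ : V N × V N → ℝ)
    (hφ : Measurable φ)
    (hi : ∀ x ∈ S, Integrable (fun y => lik (√lam) x y * φ (x, y)) (_root_.stdGaussian N)) :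
    Integrable φ (jointLaw N S lam) ∧ ∫ q, φ q ∂(jointLaw N S lam) =
      ∑ x ∈ S, uw S x * ∫ y, lik (√lam) x y * φ (x, y) ∂(_root_.stdGaussian N) := by
  have hc : (S.card : ℝ≥0∞) ≠ 0 := by exact_mod_cast hne.card_pos.ne'
  have hml : ∀ x : V N, Measurable (fun y => ENNReal.ofReal (lik (√lam) x y)) := fun x =>
    (measurable_lik _ x).ennreal_ofReal
  have i1 : ∀ x ∈ S, Integrable φ ((likM (√lam) x).map (fun y => (x, y))) := by
    intro x hx
    rw [integrable_map_measure hφ.aestronglyMeasurable (measurable_mk x).aemeasurable, likM,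
      integrable_withDensity_iff_integrable_smul' (hml x) (by simp)]
    refine (hi x hx).congr (ae_of_all _ fun y => ?_)
    simp [ENNReal.toReal_ofReal (lik_pos (√lam) x y).le]
  have i2 : Integrable φ (∑ x ∈ S, (likM (√lam) x).map (fun y => (x, y))) :=
    integrable_finsetSum_measure.2 i1
  rw [jointLaw_eq hS hne]
  refine ⟨i2.smul_measure (by simp [hc]), ?_⟩
  rw [integral_smul_measure, integral_finsetSum_measure i1, smul_eq_mul, Finset.mul_sum]
  refine Finset.sum_congr rfl fun x hx => ?_
  congr 1
  · simp [uw]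
  · rw [integral_map (measurable_mk x).aemeasurable hφ.aestronglyMeasurable, likM,
      integral_withDensity_eq_integral_toReal_smul (hml x) (by simp)]
    refine integral_congr_ae (ae_of_all _ fun y => ?_)
    simp [ENNReal.toReal_ofReal (lik_pos (√lam) x y).le]

lemma abs_coord_le {w : V N → ℝ} (h : Good S w) {x : V N} (hx : x ∈ S) (i : Fin N) :
    |x i| ≤ 1 := by
  have h1 := h.sph x hx
  rw [← sq_le_one_iff_abs_le_one, ← h1, pow_two]
  exact Finset.single_le_sum (f := fun i => x i * x i) (fun j _ => mul_self_nonneg _)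
    (Finset.mem_univ i)

/-- posterior mean -/
def pm (S : Finset (V N)) (r : ℝ) (y : V N) : V N := (mix S (uw S) r y)⁻¹ • bar S (uw S) r y

lemma measurable_pm (S : Finset (V N)) (r : ℝ) : Measurable (pm S r) :=
  (measurable_mix S _ r).inv.smul (measurable_bar S _ r)

lemma bar_apply (w : V N → ℝ) (r : ℝ) (y : V N) (i : Fin N) :
    bar S w r y i = ∑ x ∈ S, w x * lik r x y * x i := by
  unfold bar; simp [Finset.sum_apply]

lemma abs_pm_le (hS : onSphere S) (hne : S.Nonempty) (r : ℝ) (y : V N) (i : Fin N) :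
    |pm S r y i| ≤ 1 := by
  have h := good_uw hS hne
  have hp := mix_pos h r y
  unfold pm
  rw [Pi.smul_apply, smul_eq_mul, abs_mul, abs_of_pos (inv_pos.2 hp), inv_mul_le_iff₀ hp, mul_one,
    bar_apply]
  refine (Finset.abs_sum_le_sum_abs _ _).trans (Finset.sum_le_sum fun x hx => ?_)
  have h0 : 0 ≤ uw S x * lik r x y := mul_nonneg (h.nonneg x hx) (lik_pos _ _ _).le
  rw [abs_mul, abs_of_nonneg h0]
  exact mul_le_of_le_one_right h0 (abs_coord_le h hx i)

lemma integrable_lik_bdd (r : ℝ) (x : V N) (ψ : V N → ℝ) (hψ : Measurable ψ) (C : ℝ)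
    (hC : ∀ y, |ψ y| ≤ C) :
    Integrable (fun y => lik r x y * ψ y) (_root_.stdGaussian N) := by
  refine ((integrable_lik r x).mul_const C).mono'
    ((measurable_lik r x).mul hψ).aestronglyMeasurable (ae_of_all _ fun y => ?_)
  rw [norm_mul, Real.norm_eq_abs, Real.norm_eq_abs, abs_of_pos (lik_pos r x y)]
  exact mul_le_mul_of_nonneg_left (hC y) (lik_pos r x y).le

instance finite_joint (N : ℕ) (S : Finset (V N)) (lam : ℝ) : IsFiniteMeasure (jointLaw N S lam) := by
  rcases S.eq_empty_or_nonempty with rfl | hne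
  · unfold jointLaw unifOn
    simp only [Finset.sum_empty, smul_zero, Measure.zero_prod, Measure.map_zero]
    infer_instance
  · have : IsFiniteMeasure (unifOn S) := by
      refine ⟨?_⟩
      have := lintegral_unifOn S (fun _ => 1)
      rw [lintegral_one] at this
      rw [this]
      refine ENNReal.mul_lt_top ?_ ?_
      · simpa using hne
      · simp
    unfold jointLaw
    infer_instance

lemma sigmaY_le (N : ℕ) : sigmaY N ≤ (inferInstance : MeasurableSpace (V N × V N)) :=
  measurable_snd.comap_le

lemma sum_lik_eq (r : ℝ) (S : Finset (V N)) (ψ : V N → ℝ) (hψ : Measurable ψ) (C : ℝ)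
    (hC : ∀ y, |ψ y| ≤ C) (c : V N → ℝ) :
    ∑ x ∈ S, uw S x * ∫ y, lik r x y * (c x * ψ y) ∂(_root_.stdGaussian N) =
      ∫ y, (∑ x ∈ S, uw S x * lik r x y * c x) * ψ y ∂(_root_.stdGaussian N) := by
  have e : ∀ y, (∑ x ∈ S, uw S x * lik r x y * c x) * ψ y =
      ∑ x ∈ S, uw S x * (c x * (lik r x y * ψ y)) := by
    intro y
    rw [Finset.sum_mul]
    exact Finset.sum_congr rfl fun x _ => by ring
  simp_rw [e]
  rw [integral_finsetSum _ fun x _ =>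
    ((integrable_lik_bdd r x ψ hψ C hC).const_mul (c x)).const_mul _]
  refine Finset.sum_congr rfl fun x _ => ?_
  rw [integral_const_mul]
  congr 1
  exact integral_congr_ae (ae_of_all _ fun y => by ring)

lemma condExp_joint (hS : onSphere S) (hne : S.Nonempty) (lam : ℝ) (i : Fin N) :
    (fun q : V N × V N => pm S (√lam) q.2 i) =ᵐ[jointLaw N S lam]
      (jointLaw N S lam)[fun q => q.1 i | sigmaY N] := by
  have h := good_uw hS hne
  have hpm : Measurable (fun y => pm S (√lam) y i) :=
    (measurable_pi_apply i).comp (measurable_pm S (√lam))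
  have hpm2 : Measurable (fun q : V N × V N => pm S (√lam) q.2 i) := hpm.comp measurable_snd
  have hx1 : Measurable (fun q : V N × V N => q.1 i) := by fun_prop
  have ix : Integrable (fun q : V N × V N => q.1 i) (jointLaw N S lam) :=
    (integral_joint hS hne lam _ hx1 (fun x hx => integrable_lik_bdd _ x (fun _ => x i)
      measurable_const 1 (fun _ => abs_coord_le h hx i))).1
  have ig : Integrable (fun q : V N × V N => pm S (√lam) q.2 i) (jointLaw N S lam) :=
    (integral_joint hS hne lam _ hpm2 (fun x _ => integrable_lik_bdd _ x _
      hpm 1 (fun y => abs_pm_le hS hne _ y i))).1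
  refine ae_eq_condExp_of_forall_setIntegral_eq (sigmaY_le N) ix (fun _ _ _ => ig.integrableOn)
    ?_ ?_
  · rintro s ⟨B, hB, rfl⟩ _
    have hs : MeasurableSet (Prod.snd ⁻¹' B : Set (V N × V N)) := measurable_snd hB
    have hone : Measurable (B.indicator (fun _ => (1 : ℝ))) := measurable_const.indicator hB
    have hone' : ∀ y, |B.indicator (fun _ => (1 : ℝ)) y| ≤ 1 := by
      intro y; by_cases hy : y ∈ B <;> simp [hy]
    have hψ1 : Measurable (fun y => pm S (√lam) y i * B.indicator (fun _ => (1 : ℝ)) y) :=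
      hpm.mul hone
    have hψ1' : ∀ y, |pm S (√lam) y i * B.indicator (fun _ => (1 : ℝ)) y| ≤ 1 := by
      intro y
      rw [abs_mul]
      exact mul_le_one₀ (abs_pm_le hS hne _ y i) (abs_nonneg _) (hone' y)
    rw [← integral_indicator hs, ← integral_indicator hs]
    have e1 : (Prod.snd ⁻¹' B : Set (V N × V N)).indicator
        (fun q : V N × V N => pm S (√lam) q.2 i) =
        fun q => 1 * (pm S (√lam) q.2 i * B.indicator (fun _ => (1 : ℝ)) q.2) := by
      ext q; by_cases hq : q.2 ∈ B <;> simp [Set.indicator, hq]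
    have e2 : (Prod.snd ⁻¹' B : Set (V N × V N)).indicator (fun q : V N × V N => q.1 i) =
        fun q => q.1 i * B.indicator (fun _ => (1 : ℝ)) q.2 := by
      ext q; by_cases hq : q.2 ∈ B <;> simp [Set.indicator, hq]
    rw [e1, e2]
    have E1 := (integral_joint hS hne lam
      (fun q => 1 * (pm S (√lam) q.2 i * B.indicator (fun _ => (1 : ℝ)) q.2))
      ((hψ1.comp measurable_snd).const_mul 1)
      (fun x _ => integrable_lik_bdd _ x _ (hψ1.const_mul 1) 1
        (fun y => by simpa using hψ1' y))).2
    have E2 := (integral_joint hS hne lam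
      (fun q => q.1 i * B.indicator (fun _ => (1 : ℝ)) q.2)
      (hx1.mul (hone.comp measurable_snd))
      (fun x hx => integrable_lik_bdd _ x _ (hone.const_mul (x i)) 1
        (fun y => by
          rw [abs_mul]
          exact mul_le_one₀ (abs_coord_le h hx i) (abs_nonneg _) (hone' y)))).2
    refine E1.trans (Eq.trans ?_ E2.symm)
    refine (sum_lik_eq _ S _ hψ1 1 hψ1' (fun _ => 1)).trans ?_
    have e3 := sum_lik_eq (√lam) S _ hone 1 hone' (fun x => x i)
    refine Eq.trans ?_ e3.symm
    refine integral_congr_ae (ae_of_all _ fun y => ?_)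
    simp only [mul_one]
    rw [← bar_apply]
    have hp := mix_pos h (√lam) y
    change mix S (uw S) (√lam) y * _ = _
    unfold pm
    rw [Pi.smul_apply, smul_eq_mul]
    field_simp
  · refine Measurable.aestronglyMeasurable ?_
    exact hpm.comp (comap_measurable (m := inferInstance) (Prod.snd : V N × V N → V N))

lemma mmse_eq (hS : onSphere S) (hne : S.Nonempty) (lam : ℝ) :
    mmse N S lam = 1 - Gf S (uw S) (√lam) := by
  have h := good_uw hS hne
  have hpm : ∀ i, Measurable (fun y => pm S (√lam) y i) := fun i =>
    (measurable_pi_apply i).comp (measurable_pm S (√lam))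
  have step1 : ∀ i : Fin N,
      ∫ ω, (ω.1 i - ((jointLaw N S lam)[fun ω' => ω'.1 i | sigmaY N]) ω) ^ 2
      ∂(jointLaw N S lam) = ∑ x ∈ S, uw S x * ∫ y, lik (√lam) x y *
        (x i - pm S (√lam) y i) ^ 2 ∂(_root_.stdGaussian N) := by
    intro i
    have e : ∫ ω, (ω.1 i - ((jointLaw N S lam)[fun ω' => ω'.1 i | sigmaY N]) ω) ^ 2
      ∂(jointLaw N S lam) = ∫ ω, (ω.1 i - pm S (√lam) ω.2 i) ^ 2 ∂(jointLaw N S lam) := by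
      refine integral_congr_ae ?_
      filter_upwards [condExp_joint hS hne lam i] with q hq
      rw [hq]
    rw [e]
    have hm : Measurable (fun q : V N × V N => (q.1 i - pm S (√lam) q.2 i) ^ 2) := by
      have : Measurable (fun q : V N × V N => pm S (√lam) q.2 i) := (hpm i).comp measurable_snd
      have h2 : Measurable (fun q : V N × V N => q.1 i) := by fun_prop
      exact (h2.sub this).pow_const 2
    exact (integral_joint hS hne lam _ hm (fun x hx => integrable_lik_bdd _ x _
      ((measurable_const.sub (hpm i)).pow_const 2) 4 (fun y => by
        have a1 := abs_le.1 (abs_coord_le h hx i)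
        have a2 := abs_le.1 (abs_pm_le hS hne (√lam) y i)
        rw [abs_of_nonneg (sq_nonneg _)]
        nlinarith))).2
  have ii : ∀ i, ∀ x ∈ S, Integrable (fun y => lik (√lam) x y * (x i - pm S (√lam) y i) ^ 2)
      (_root_.stdGaussian N) := by
    intro i x hx
    exact integrable_lik_bdd _ x _
      ((measurable_const.sub (hpm i)).pow_const 2) 4 (fun y => by
        have a1 := abs_le.1 (abs_coord_le h hx i)
        have a2 := abs_le.1 (abs_pm_le hS hne (√lam) y i)
        rw [abs_of_nonneg (sq_nonneg _)]
        nlinarith)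
  unfold mmse
  simp_rw [step1]
  rw [Finset.sum_comm]
  have e2 : ∑ x ∈ S, ∑ i : Fin N, uw S x * ∫ y, lik (√lam) x y *
        (x i - pm S (√lam) y i) ^ 2 ∂(_root_.stdGaussian N) =
      ∫ y, ∑ x ∈ S, uw S x * ∑ i : Fin N, lik (√lam) x y *
        (x i - pm S (√lam) y i) ^ 2 ∂(_root_.stdGaussian N) := by
    rw [integral_finsetSum _ fun x hx => (integrable_finsetSum _ fun i _ => ii i x hx).const_mul _]
    refine Finset.sum_congr rfl fun x hx => ?_
    rw [integral_const_mul, integral_finsetSum _ fun i _ => ii i x hx, Finset.mul_sum]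
  rw [e2, ← integral_mix h (√lam), Gf, ← integral_sub (integrable_mix S _ _) (integrable_Gint h _)]
  refine integral_congr_ae (ae_of_all _ fun y => ?_)
  simp only
  have hp := mix_pos h (√lam) y
  have e3 : ∀ x ∈ S, uw S x * ∑ i : Fin N, lik (√lam) x y * (x i - pm S (√lam) y i) ^ 2 =
      uw S x * lik (√lam) x y + inp (pm S (√lam) y) (pm S (√lam) y) * (uw S x * lik (√lam) x y)
        - 2 * (uw S x * inp x (pm S (√lam) y) * lik (√lam) x y) := by
    intro x hx
    have : ∑ i : Fin N, (x i - pm S (√lam) y i) ^ 2 = inp x x +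
        inp (pm S (√lam) y) (pm S (√lam) y) - 2 * inp x (pm S (√lam) y) := by
      unfold inp
      rw [Finset.mul_sum, ← Finset.sum_add_distrib, ← Finset.sum_sub_distrib]
      exact Finset.sum_congr rfl fun i _ => by ring
    rw [← Finset.mul_sum, this, h.sph x hx]
    ring
  rw [Finset.sum_congr rfl e3, Finset.sum_sub_distrib, Finset.sum_add_distrib, ← Finset.mul_sum,
    ← Finset.mul_sum, ← inp_bar_left]
  change mix S (uw S) (√lam) y + _ * mix S (uw S) (√lam) y - _ = _
  unfold pm
  rw [inp_smul_left, inp_smul_right]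
  field_simp
  ring

end


/-- The real-analytic facts on which the final argument is based. -/
structure Facts (D G : ℕ → ℝ → ℝ) (L : ℕ → ℝ) : Prop where
  hL : Tendsto L atTop atTop
  ev : ∀ᶠ N in atTop, 0 < L N ∧ D N 0 = 0 ∧ ∀ a, 0 ≤ a → 0 ≤ D N a ∧ 0 ≤ G N a ∧ G N a ≤ 1 ∧
    a / 2 - L N ≤ D N a ∧ ∀ b, a < b → D N a + (b - a) / 2 * G N a ≤ D N b ∧
      D N b ≤ D N a + (b - a) / 2 * G N b
  up : ∀ ε : ℝ, 0 < ε → ε < 1 → ∃ t : ℝ, t < 1 ∧ ∀ᶠ N in atTop, ∀ a, 0 ≤ a →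
    D N a ≤ a / 2 + Real.log 2 - (1 - ε) * L N * (1 - (1 - G N a) / (1 - t))

lemma Facts.below {D G : ℕ → ℝ → ℝ} {L : ℕ → ℝ} (F : Facts D G L)
    (h : Tendsto (fun N => D N (2 * L N) / L N) atTop (nhds 0)) (β : ℝ) (h0 : 0 ≤ β) (h1 : β < 1) :
    Tendsto (fun N => 1 - G N (β * (2 * L N))) atTop (nhds 1) := by
  have hG : Tendsto (fun N => G N (β * (2 * L N))) atTop (nhds 0) := by
    have h2 : Tendsto (fun N => D N (2 * L N) / L N / (1 - β)) atTop (nhds 0) := by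
      simpa using h.div_const (1 - β)
    refine squeeze_zero' ?_ ?_ h2
    · filter_upwards [F.ev] with N ⟨hL, _, H⟩
      exact (H _ (by positivity)).2.1
    · filter_upwards [F.ev] with N ⟨hL, _, H⟩
      obtain ⟨a1, a2, a3, a4, a5⟩ := H (β * (2 * L N)) (by positivity)
      have a6 := (a5 (2 * L N) (by nlinarith)).1
      have : 0 < 1 - β := by linarith
      rw [div_div, le_div_iff₀ (by positivity)]
      nlinarith
  simpa using hG.const_sub 1

lemma Facts.above {D G : ℕ → ℝ → ℝ} {L : ℕ → ℝ} (F : Facts D G L)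
    (h : Tendsto (fun N => D N (2 * L N) / L N) atTop (nhds 0)) (β : ℝ) (h1 : 1 < β) :
    Tendsto (fun N => 1 - G N (β * (2 * L N))) atTop (nhds 0) := by
  have h2 : Tendsto (fun N => D N (2 * L N) / L N / (β - 1)) atTop (nhds 0) := by
    simpa using h.div_const (β - 1)
  refine squeeze_zero' ?_ ?_ h2
  · filter_upwards [F.ev] with N ⟨hL, _, H⟩
    have := (H (β * (2 * L N)) (by positivity)).2.2.1
    linarith
  · filter_upwards [F.ev] with N ⟨hL, _, H⟩
    have b4 := (H (β * (2 * L N)) (by positivity)).2.2.2.1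
    obtain ⟨a1, a2, a3, a4, a5⟩ := H (2 * L N) (by positivity)
    have a6 := (a5 (β * (2 * L N)) (by nlinarith)).2
    have : 0 < β - 1 := by linarith
    rw [div_div, le_div_iff₀ (by positivity)]
    nlinarith

lemma Facts.forward {D G : ℕ → ℝ → ℝ} {L : ℕ → ℝ} (F : Facts D G L) (lam : ℕ → ℝ)
    (hlam : ∀ N, 0 < lam N)
    (hb : ∀ β : ℝ, 0 ≤ β → β < 1 → Tendsto (fun N => 1 - G N (β * lam N)) atTop (nhds 1))
    (ha : ∀ β : ℝ, 1 < β → Tendsto (fun N => 1 - G N (β * lam N)) atTop (nhds 0)) :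
    Tendsto (fun N => D N (2 * L N) / L N) atTop (nhds 0) := by
  have key : ∀ δ : ℝ, 0 < δ → δ < 1 / 2 → ∀ᶠ N in atTop, D N (2 * L N) / L N ≤ 12 * δ := by
    intro δ hδ hδ2
    obtain ⟨t, ht, hup⟩ := F.up (δ / 16) (by positivity) (by linarith)
    have hm : ∀ᶠ N in atTop, 1 - G N ((1 + δ / 2) * lam N) < (1 - t) * (δ / 16) :=
      (ha (1 + δ / 2) (by linarith)).eventually_lt_const (by
        have : 0 < 1 - t := by linarith
        positivity)
    have hg : ∀ᶠ N in atTop, 1 - δ < 1 - G N ((1 - δ) * lam N) :=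
      (hb (1 - δ) (by linarith) (by linarith)).eventually_const_lt (by linarith)
    have hg2 : ∀ᶠ N in atTop, 1 / 2 < 1 - G N (1 / 2 * lam N) :=
      (hb (1 / 2) (by norm_num) (by norm_num)).eventually_const_lt (by norm_num)
    have hlog : ∀ᶠ N in atTop, Real.log 2 / (δ / 16) ≤ L N := F.hL.eventually_ge_atTop _
    filter_upwards [F.ev, hup, hm, hg, hg2, hlog] with N ⟨hL, hD0, H⟩ hup hm hg hg2 hlog
    have hl := hlam N
    rw [div_le_iff₀ (by positivity)] at hlog
    -- upper bound on the critical value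
    have c1 : lam N ≤ 8 * L N := by
      have x1 := (H _ (le_refl 0)).2.2.2.2 (1 / 2 * lam N) (by positivity)
      have x2 := H (1 / 2 * lam N) (by positivity)
      have x3 := x2.2.2.2.2 (lam N) (by linarith)
      have x4 := H (lam N) hl.le
      rw [hD0] at x1
      nlinarith [x1.2, x3.2, x4.2.2.2.1, x4.2.2.1]
    -- lower bound on the critical value
    have c2 : 2 * L N ≤ (1 + δ) * lam N := by
      have x1 := hup ((1 + δ / 2) * lam N) (by positivity)
      have x2 := (H ((1 + δ / 2) * lam N) (by positivity)).1
      have x3 : (1 - G N ((1 + δ / 2) * lam N)) / (1 - t) ≤ δ / 16 := by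
        rw [div_le_iff₀ (by linarith)]
        linarith
      have x4 : (1 - δ / 16) * L N * (1 - δ / 16) ≤
          (1 - δ / 16) * L N * (1 - (1 - G N ((1 + δ / 2) * lam N)) / (1 - t)) := by
        refine mul_le_mul_of_nonneg_left (by linarith) ?_
        exact mul_nonneg (by linarith) hL.le
      have x5 : (1 - 3 * δ / 16) * L N ≤ (1 + δ / 2) * lam N / 2 := by nlinarith [sq_nonneg δ]
      have x6 : (1 + δ / 2) * (2 * L N) ≤ (1 + δ / 2) * ((1 + δ) * lam N) := by
        have x7 : (1 + δ) * ((1 - 3 * δ / 16) * L N) ≤ (1 + δ) * ((1 + δ / 2) * lam N / 2) :=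
          mul_le_mul_of_nonneg_left x5 (by linarith)
        have x8 : (1 + δ / 2) * L N ≤ (1 + δ) * (1 - 3 * δ / 16) * L N :=
          mul_le_mul_of_nonneg_right (by nlinarith) hL.le
        nlinarith
      exact le_of_mul_le_mul_left x6 (by linarith)
    have x0 : (0 : ℝ) < (1 - δ) * lam N := mul_pos (by linarith) hl
    have y1 := ((H _ (le_refl 0)).2.2.2.2 ((1 - δ) * lam N) x0).2
    have y2 := H ((1 - δ) * lam N) x0.le
    have y3 := (y2.2.2.2.2 ((1 + δ) * lam N) (by nlinarith)).2
    have y4 := H ((1 + δ) * lam N) (by positivity)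
    have y5 : D N (2 * L N) ≤ D N ((1 + δ) * lam N) := by
      rcases c2.eq_or_lt with e | e
      · rw [e]
      · have z := H (2 * L N) (by positivity)
        have z2 := (z.2.2.2.2 _ e).1
        have : 0 ≤ ((1 + δ) * lam N - 2 * L N) / 2 * G N (2 * L N) :=
          mul_nonneg (by linarith) z.2.1
        linarith
    rw [hD0] at y1
    rw [div_le_iff₀ hL]
    have z1 : ((1 + δ) * lam N - (1 - δ) * lam N) / 2 * G N ((1 + δ) * lam N) ≤
        ((1 + δ) * lam N - (1 - δ) * lam N) / 2 * 1 :=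
      mul_le_mul_of_nonneg_left y4.2.2.1 (by nlinarith)
    have z2 : ((1 - δ) * lam N - 0) / 2 * G N ((1 - δ) * lam N) ≤
        ((1 - δ) * lam N - 0) / 2 * δ :=
      mul_le_mul_of_nonneg_left (by linarith) (by linarith)
    have z3 : D N (2 * L N) ≤ lam N * (3 / 2 * δ) := by
      nlinarith [mul_pos (mul_pos hδ hδ) hl]
    have z4 : lam N * (3 / 2 * δ) ≤ 8 * L N * (3 / 2 * δ) :=
      mul_le_mul_of_nonneg_right c1 (by positivity)
    linarith
  rw [Metric.tendsto_nhds]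
  intro ε hε
  have hk := key (min (ε / 24) (1 / 4)) (by positivity) (by
    have := min_le_right (ε / 24) (1 / 4 : ℝ)
    linarith)
  filter_upwards [hk, F.ev] with N h1 ⟨hL, _, H⟩
  have h2 : 0 ≤ D N (2 * L N) / L N := div_nonneg (H _ (by positivity)).1 hL.le
  rw [Real.dist_eq, sub_zero, abs_of_nonneg h2]
  have := min_le_left (ε / 24) (1 / 4 : ℝ)
  linarith

lemma overlap_le {N : ℕ} (S : Finset (V N)) (hne : S.Nonempty) (t e : ℝ)
    (h : ((unifOn S).prod (unifOn S)) {q | t ≤ inp q.1 q.2} ≤ (S.card : ℝ≥0∞) ^ (-e)) :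
    Real.exp (e * Real.log S.card) * (∑ x ∈ S, ∑ x' ∈ S, ovl t x x') ≤ (S.card : ℝ) ^ 2 := by
  have hc : (0 : ℝ) < S.card := by exact_mod_cast hne.card_pos
  have hmeas : MeasurableSet {q : V N × V N | t ≤ inp q.1 q.2} := by
    refine measurableSet_le measurable_const ?_
    unfold inp
    fun_prop
  have e1 : ((unifOn S).prod (unifOn S)) {q | t ≤ inp q.1 q.2} =
      ENNReal.ofReal ((S.card : ℝ)⁻¹ * ((S.card : ℝ)⁻¹ * ∑ x ∈ S, ∑ x' ∈ S, ovl t x x')) := by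
    rw [Measure.prod_apply hmeas, lintegral_unifOn]
    have e2 : ∀ x : V N, (unifOn S) (Prod.mk x ⁻¹' {q : V N × V N | t ≤ inp q.1 q.2}) =
        (S.card : ℝ≥0∞)⁻¹ * ∑ x' ∈ S, ENNReal.ofReal (ovl t x x') := by
      intro x
      rw [← lintegral_indicator_one (measurable_prodMk_left hmeas), lintegral_unifOn]
      congr 1
      refine Finset.sum_congr rfl fun x' _ => ?_
      unfold ovl
      by_cases hx : t ≤ inp x x' <;> simp [Set.indicator, hx]
    have h0 : ∀ x x' : V N, 0 ≤ ovl t x x' := by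
      intro x x'
      unfold ovl
      split_ifs <;> norm_num
    have hci : ENNReal.ofReal ((S.card : ℝ)⁻¹) = (S.card : ℝ≥0∞)⁻¹ := by
      rw [ENNReal.ofReal_inv_of_pos hc, ENNReal.ofReal_natCast]
    have hs : ∀ x ∈ S, 0 ≤ ∑ x' ∈ S, ovl t x x' :=
      fun x _ => Finset.sum_nonneg fun x' _ => h0 x x'
    rw [ENNReal.ofReal_mul (by positivity), ENNReal.ofReal_mul (by positivity), hci,
      ENNReal.ofReal_sum_of_nonneg hs]
    congr 1
    rw [Finset.mul_sum]
    refine Finset.sum_congr rfl fun x _ => ?_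
    rw [e2, ENNReal.ofReal_sum_of_nonneg fun x' _ => h0 x x']
  have e3 : (S.card : ℝ≥0∞) ^ (-e) = ENNReal.ofReal (Real.exp (-(e * Real.log S.card))) := by
    rw [← ENNReal.ofReal_natCast, ENNReal.ofReal_rpow_of_pos hc, Real.rpow_def_of_pos hc]
    congr 2
    ring
  rw [e1, e3, ENNReal.ofReal_le_ofReal_iff (Real.exp_pos _).le, Real.exp_neg] at h
  have hE := Real.exp_pos (e * Real.log S.card)
  have := mul_le_mul_of_nonneg_left h hE.le
  rw [mul_inv_cancel₀ hE.ne'] at this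
  have h4 := mul_le_mul_of_nonneg_left this (by positivity : (0 : ℝ) ≤ (S.card : ℝ) ^ 2)
  rw [mul_one] at h4
  refine le_trans (le_of_eq ?_) h4
  field_simp

lemma KLf_zero' {N : ℕ} {S : Finset (V N)} {w : V N → ℝ} (h : Good S w) : KLf S w 0 = 0 := by
  unfold KLf mix lik
  simp [h.sum]

lemma facts (S : ∀ N : ℕ, Finset (V N)) (hsphere : ∀ N, onSphere (S N))
    (hM : Tendsto (fun N => (S N).card) atTop atTop) (hspread : spread S) :
    Facts (fun N a => KLf (S N) (uw (S N)) (√a)) (fun N a => Gf (S N) (uw (S N)) (√a))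
      (fun N => Real.log (S N).card) where
  hL := Real.tendsto_log_atTop.comp (tendsto_natCast_atTop_atTop.comp hM)
  ev := by
    filter_upwards [hM.eventually_ge_atTop 2] with N hN
    have hne : (S N).Nonempty := Finset.card_pos.1 (by omega)
    have h := good_uw (hsphere N) hne
    refine ⟨Real.log_pos (by exact_mod_cast hN), ?_, ?_⟩
    · simp only [Real.sqrt_zero]
      exact KLf_zero' h
    · intro a ha
      have := KLf_ge (hsphere N) hne (√a)
      rw [Real.sq_sqrt ha] at this
      exact ⟨KLf_nonneg h _, Gf_nonneg h _, Gf_le_one h _, this,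
        fun b hab => ⟨Dl_lower h ha hab, Dl_upper h ha hab⟩⟩
  up := by
    intro ε hε hε1
    obtain ⟨t₀, ht₀, H⟩ := hspread (ε / 2) (by positivity)
    refine ⟨(max t₀ 0 + 1) / 2, ?_, ?_⟩
    · have : max t₀ 0 < 1 := max_lt ht₀ one_pos
      linarith
    have hlt : max t₀ 0 < 1 := max_lt ht₀ one_pos
    have hle := le_max_left t₀ 0
    filter_upwards [H ((max t₀ 0 + 1) / 2) (by linarith) (by linarith) (ε / 2) (by positivity),
      hM.eventually_ge_atTop 2] with N h1 hN a ha
    have hne : (S N).Nonempty := Finset.card_pos.1 (by omega)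
    have h2 : -1 + ε / 2 + ε / 2 = -(1 - ε) := by ring
    rw [h2] at h1
    have h3 := overlap_le (S N) hne _ _ h1
    have h4 := KLf_le (hsphere N) hne (√a) (by linarith) (mul_nonneg (by linarith)
      (Real.log_nonneg (by exact_mod_cast (by omega : 1 ≤ (S N).card)))) h3
    rw [Real.sq_sqrt ha] at h4
    exact h4


/-- Theorem 1 of the paper. Under the spread assumption and `M_N → ∞`,
the sequence of priors satisfies the all-or-nothing phenomenon with some critical SNR
sequence if and only if `D(Q_{2 log M_N, N} ‖ Q_{0,N}) = o(log M_N)`; moreover, in that case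
one may take `λ_N = 2 log M_N` as the critical SNR. -/
theorem statement0 (S : ∀ N : ℕ, Finset (V N)) (hsphere : ∀ N, onSphere (S N))
    (hM : Tendsto (fun N => (S N).card) atTop atTop)
    (hspread : spread S) :
    ((∃ lam : ℕ → ℝ, (∀ N, 0 < lam N) ∧ allOrNothing S lam) ↔
      Tendsto
        (fun N => klReal (Q N (S N) (2 * Real.log (S N).card)) (Q N (S N) 0)
          / Real.log (S N).card) atTop (nhds 0)) ∧
    (Tendsto
        (fun N => klReal (Q N (S N) (2 * Real.log (S N).card)) (Q N (S N) 0)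
          / Real.log (S N).card) atTop (nhds 0) →
      allOrNothing S (fun N => 2 * Real.log (S N).card)) := by
  have F := facts S hsphere hM hspread
  have hne : ∀ᶠ N in atTop, (S N).Nonempty := by
    filter_upwards [hM.eventually_ge_atTop 2] with N hN
    exact Finset.card_pos.1 (by omega)
  have ekl : (fun N => klReal (Q N (S N) (2 * Real.log (S N).card)) (Q N (S N) 0)
      / Real.log (S N).card) =ᶠ[atTop]
      fun N => KLf (S N) (uw (S N)) (√(2 * Real.log (S N).card)) / Real.log (S N).card := by
    filter_upwards [hne] with N hN
    rw [kl_eq (hsphere N) hN]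
  have em : ∀ l : ℕ → ℝ, (fun N => mmse N (S N) (l N)) =ᶠ[atTop]
      fun N => 1 - Gf (S N) (uw (S N)) (√(l N)) := by
    intro l
    filter_upwards [hne] with N hN
    exact mmse_eq (hsphere N) hN _
  have back : Tendsto
        (fun N => klReal (Q N (S N) (2 * Real.log (S N).card)) (Q N (S N) 0)
          / Real.log (S N).card) atTop (nhds 0) →
      allOrNothing S (fun N => 2 * Real.log (S N).card) := by
    intro h
    rw [tendsto_congr' ekl] at h
    refine ⟨fun β h0 h1 => ?_, fun β h1 => ?_⟩
    · rw [tendsto_congr' (em _)]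
      exact F.below h β h0 h1
    · rw [tendsto_congr' (em _)]
      exact F.above h β h1
  refine ⟨⟨?_, ?_⟩, back⟩
  · rintro ⟨lam, hlam, hb, ha⟩
    rw [tendsto_congr' ekl]
    refine F.forward lam hlam (fun β h0 h1 => ?_) (fun β h1 => ?_)
    · exact (tendsto_congr' (em fun N => β * lam N)).1 (hb β h0 h1)
    · exact (tendsto_congr' (em fun N => β * lam N)).1 (ha β h1)
  · intro h
    obtain ⟨hb, ha⟩ := back h
    have hev : ∀ᶠ N in atTop, max 1 (2 * Real.log (S N).card) = 2 * Real.log (S N).card := by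
      filter_upwards [F.hL.eventually_ge_atTop 1] with N hN
      exact max_eq_right (by linarith)
    refine ⟨fun N => max 1 (2 * Real.log (S N).card),
      fun N => lt_of_lt_of_le one_pos (le_max_left _ _), fun β h0 h1 => ?_, fun β h1 => ?_⟩
    · refine (tendsto_congr' ?_).1 (hb β h0 h1)
      filter_upwards [hev] with N hN
      rw [hN]
    · refine (tendsto_congr' ?_).1 (ha β h1)
      filter_upwards [hev] with N hN
      rw [hN]
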